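/- arXiv:2010.00395 — 2 statements merged into one kernel-verified Lean document; each statement's English description precedes it below -/
import Mathlib

section
/- Let n ≥ 2 and let K and L be convex bodies in ℝⁿ containing the origin in their interiors with γ_n(K) = γ_n(L). Then ∫_{S^{n-1}} h_L(v) dS_{γ_n,K}(v) ≥ ∫_{S^{n-1}} h_K(v) dS_{γ_n,K}(v), with equality if and only if K = L. -/
open MeasureTheory Metric Set Filter
open scoped RealInnerProductSpace Topology Pointwise NNReal ENNReal

noncomputable section

/-- `ℝⁿ` as Euclidean space. -/
abbrev Eu (n : ℕ) := EuclideanSpace ℝ (Fin n)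

/-- The Gaussian measure `γₙ(A) = (2π)^{-n/2} ∫_A e^{-|x|²/2} dx`. -/
def gaussVol (n : ℕ) (A : Set (Eu n)) : ℝ :=
  (Real.sqrt (2 * Real.pi))⁻¹ ^ n * ∫ x in A, Real.exp (-‖x‖ ^ 2 / 2)

/-- A convex body: a compact convex set with nonempty interior. -/
def IsConvexBody {n : ℕ} (K : Set (Eu n)) : Prop :=
  Convex ℝ K ∧ IsCompact K ∧ (interior K).Nonempty

/-- The support function `h_K(v) = max_{y ∈ K} ⟪y, v⟫`. -/
def suppFun {n : ℕ} (K : Set (Eu n)) (v : Eu n) : ℝ :=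
  sSup ((fun y => ⟪y, v⟫) '' K)

/-- The Gaussian surface area measure of `K`, as a set function:
`S_{γₙ,K}(η) = (2π)^{-n/2} ∫_{ν_K⁻¹(η)} e^{-|x|²/2} dH^{n-1}(x)`, where
`ν_K⁻¹(η)` is the set of boundary points of `K` having an outer unit normal in `η`. -/
def gaussSurf (n : ℕ) (K : Set (Eu n)) (η : Set (Eu n)) : ℝ :=
  (Real.sqrt (2 * Real.pi))⁻¹ ^ n *
    ∫ x in {x | x ∈ frontier K ∧ ∃ v ∈ η, ⟪x, v⟫ = suppFun K v},
      Real.exp (-‖x‖ ^ 2 / 2) ∂μH[(n : ℝ) - 1]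

open Classical in
/-- (A choice of) Gauss map of `K`: to a boundary point `x` it assigns an outer unit
normal of `K` at `x` (for a convex body `K`, this is unique for `H^{n-1}`-a.e. `x ∈ ∂K`). -/
def gaussMap {n : ℕ} (K : Set (Eu n)) (x : Eu n) : Eu n :=
  if h : ∃ v : Eu n, ‖v‖ = 1 ∧ ⟪x, v⟫ = suppFun K v then h.choose else 0

/-- The Wulff shape `[g] = {x : x·v ≤ g v for all unit v}`. -/
def wulff {n : ℕ} (g : Eu n → ℝ) : Set (Eu n) :=
  {x | ∀ v : Eu n, ‖v‖ = 1 → ⟪x, v⟫ ≤ g v}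

/-- The radial function `ρ_K(u) = max {r : r • u ∈ K}`. -/
def radialFun {n : ℕ} (K : Set (Eu n)) (u : Eu n) : ℝ :=
  sSup {r : ℝ | r • u ∈ K}

/-- The standard Gaussian distribution function `Φ`. -/
def Phi (x : ℝ) : ℝ :=
  (Real.sqrt (2 * Real.pi))⁻¹ * ∫ t in Iic x, Real.exp (-t ^ 2 / 2)

/-- The inverse `Φ⁻¹` of the standard Gaussian distribution function. -/
def PhiInv : ℝ → ℝ := Function.invFun Phi


theorem bm1_aux {s c : ℝ} (hs : 0 < s) (A : Set ℝ) :
    volume ((fun x => c + s * x) '' A) = ENNReal.ofReal s * volume A := by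
  have h1 : (fun x => c + s * x) '' A = (fun x => c + x) '' (s • A) := by
    rw [← Set.image_smul, Set.image_image]; rfl
  rw [h1, Set.image_add_left, measure_preimage_add, Measure.addHaar_smul]
  simp [abs_of_pos hs]

theorem bm1_compact {t : ℝ} (ht0 : 0 < t) (ht1 : t < 1) {A B C : Set ℝ} (hA : IsCompact A)
    (hB : IsCompact B) (hAn : A.Nonempty) (hBn : B.Nonempty)
    (h : ∀ x ∈ A, ∀ y ∈ B, (1 - t) * x + t * y ∈ C) :
    ENNReal.ofReal (1 - t) * volume A + ENNReal.ofReal t * volume B ≤ volume C := by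
  obtain ⟨a, haA, ha⟩ := hA.exists_isGreatest hAn
  obtain ⟨b, hbB, hb⟩ := hB.exists_isLeast hBn
  have ht1' : 0 < 1 - t := sub_pos.2 ht1
  rw [← bm1_aux ht1' (c := t * b) A, ← bm1_aux ht0 (c := (1 - t) * a) B]
  rw [← measure_union₀']
  · apply measure_mono
    rintro _ (⟨x, hx, rfl⟩ | ⟨y, hy, rfl⟩)
    · simpa [add_comm] using h x hx b hbB
    · exact h a haA y hy
  · exact (hA.image (by fun_prop)).measurableSet.nullMeasurableSet
  · refine measure_mono_null (t := {(1 - t) * a + t * b}) ?_ (by simp)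
    rintro z ⟨⟨x, hx, rfl⟩, ⟨y, hy, hxy⟩⟩
    have h1 := ha hx
    have h2 := hb hy
    simp only [mem_singleton_iff] at *
    nlinarith [mul_nonneg ht1'.le (sub_nonneg.2 h1), mul_nonneg ht0.le (sub_nonneg.2 h2)]

theorem bm1 {t : ℝ} (ht0 : 0 < t) (ht1 : t < 1) {A B C : Set ℝ} (hA : MeasurableSet A)
    (hB : MeasurableSet B) (hAn : A.Nonempty) (hBn : B.Nonempty)
    (h : ∀ x ∈ A, ∀ y ∈ B, (1 - t) * x + t * y ∈ C) :
    ENNReal.ofReal (1 - t) * volume A + ENNReal.ofReal t * volume B ≤ volume C := by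
  obtain ⟨a, ha⟩ := hAn
  obtain ⟨b, hb⟩ := hBn
  rw [hA.measure_eq_iSup_isCompact, hB.measure_eq_iSup_isCompact]
  simp only [ENNReal.mul_iSup]
  refine ENNReal.biSup_add_biSup_le' ?_ ?_ ?_
  · exact ⟨∅, empty_subset _⟩
  · exact ⟨∅, empty_subset _⟩
  intro K1 h1 K2 h2
  by_cases c1 : IsCompact K1
  · by_cases c2 : IsCompact K2
    · simp only [c1, c2, iSup_pos]
      refine le_trans ?_ (bm1_compact ht0 ht1 (C := C) (c1.union (isCompact_singleton (x := a)))
        (c2.union (isCompact_singleton (x := b))) (by simp) (by simp) ?_)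
      · gcongr <;> exact subset_union_left
      · intro x hx y hy
        refine h x ?_ y ?_
        · rcases hx with hx | rfl
          exacts [h1 hx, ha]
        · rcases hy with hy | rfl
          exacts [h2 hy, hb]
    · simp only [c1, c2, iSup_pos, not_false_iff, iSup_neg]
      refine le_trans ?_ (bm1_compact ht0 ht1 (C := C) (c1.union (isCompact_singleton (x := a)))
        (isCompact_singleton (x := b)) (by simp) (by simp) ?_)
      · simp only [Real.volume_singleton, mul_zero]
        gcongr
        · exact subset_union_left
        · simp
      · rintro x hx y rfl
        refine h x ?_ y hb
        rcases hx with hx | rfl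
        exacts [h1 hx, ha]
  · by_cases c2 : IsCompact K2
    · simp only [c1, c2, iSup_pos, not_false_iff, iSup_neg]
      refine le_trans ?_ (bm1_compact ht0 ht1 (C := C) (isCompact_singleton (x := a))
        (c2.union (isCompact_singleton (x := b))) (by simp) (by simp) ?_)
      · simp only [Real.volume_singleton, mul_zero]
        gcongr
        · simp
        · exact subset_union_left
      · rintro x rfl y hy
        refine h x ha y ?_
        rcases hy with hy | rfl
        exacts [h2 hy, hb]
    · simp [c1, c2]

theorem pl1_norm {t : ℝ} (ht0 : 0 < t) (ht1 : t < 1) {f g h : ℝ → ℝ} (hf : Measurable f)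
    (hg : Measurable g) (hh : Measurable h) (f0 : ∀ x, 0 ≤ f x) (g0 : ∀ x, 0 ≤ g x)
    (h0 : ∀ x, 0 ≤ h x)  (f1 : ∀ x, f x ≤ 1) (g1 : ∀ x, g x ≤ 1)
    (fs : ∀ c, 0 ≤ c → c < 1 → ∃ x, c < f x) (gs : ∀ c, 0 ≤ c → c < 1 → ∃ x, c < g x)
    (H : ∀ x y c, 0 ≤ c → c < f x → c < g y → c < h ((1 - t) * x + t * y)) :
    ENNReal.ofReal (1 - t) * (∫⁻ x, ENNReal.ofReal (f x)) +
      ENNReal.ofReal t * (∫⁻ x, ENNReal.ofReal (g x)) ≤ ∫⁻ x, ENNReal.ofReal (h x) := by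
  rw [lintegral_eq_lintegral_meas_lt volume (ae_of_all _ f0) hf.aemeasurable,
    lintegral_eq_lintegral_meas_lt volume (ae_of_all _ g0) hg.aemeasurable,
    lintegral_eq_lintegral_meas_lt volume (ae_of_all _ h0) hh.aemeasurable]
  have hm : ∀ {F : ℝ → ℝ}, Measurable fun c => volume {a | c < F a} := fun {F} =>
    Antitone.measurable fun c d hcd => measure_mono fun x hx => lt_of_le_of_lt hcd hx
  rw [← lintegral_const_mul _ hm, ← lintegral_const_mul _ hm,
    ← lintegral_add_left (hm.const_mul _)]
  refine setLIntegral_mono' measurableSet_Ioi fun c hc0 => ?_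
  have hc0 : 0 ≤ c := le_of_lt hc0
  by_cases hc : c < 1
  · exact bm1 ht0 ht1 (measurableSet_lt measurable_const hf)
      (measurableSet_lt measurable_const hg) (fs c hc0 hc) (gs c hc0 hc)
      fun x hx y hy => H x y c hc0 hx hy
  · have e1 : {a | c < f a} = ∅ := by
      ext x; simpa using (f1 x).trans (not_lt.1 hc)
    have e2 : {a | c < g a} = ∅ := by
      ext x; simpa using (g1 x).trans (not_lt.1 hc)
    simp [e1, e2]

theorem ennreal_amgm {t : ℝ} (ht0 : 0 < t) (ht1 : t < 1) (a b : ℝ≥0∞) :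
    a ^ (1 - t) * b ^ t ≤ ENNReal.ofReal (1 - t) * a + ENNReal.ofReal t * b := by
  have ht1' : 0 < 1 - t := sub_pos.2 ht1
  induction a with
  | top =>
    rw [ENNReal.mul_top (by simpa using ht1)]
    simp
  | coe a =>
    induction b with
    | top => simp [ENNReal.mul_top, ht0]
    | coe b =>
      rw [← ENNReal.coe_rpow_of_nonneg _ ht1'.le, ← ENNReal.coe_rpow_of_nonneg _ ht0.le]
      lift t to ℝ≥0 using ht0.le
      have hs : (1 - t : ℝ) = ((1 - t : ℝ≥0) : ℝ) := by
        rw [NNReal.coe_sub]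
        · simp
        · exact_mod_cast ht1.le
      have := NNReal.geom_mean_le_arith_mean2_weighted (1 - t) t a b
        (tsub_add_cancel_of_le (by exact_mod_cast ht1.le))
      rw [hs, ENNReal.ofReal_coe_nnreal, ENNReal.ofReal_coe_nnreal]
      exact_mod_cast this

theorem min_le_geom {t : ℝ} (ht0 : 0 < t) (ht1 : t < 1) (a b : ℝ≥0∞) :
    min a b ≤ a ^ (1 - t) * b ^ t := by
  have ht1' : 0 < 1 - t := sub_pos.2 ht1
  calc min a b = (min a b) ^ (1 - t) * (min a b) ^ t := by
        rw [← ENNReal.rpow_add_of_nonneg _ _ ht1'.le ht0.le]; simp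
    _ ≤ _ := by gcongr <;> simp

theorem pl1_bdd {t : ℝ} (ht0 : 0 < t) (ht1 : t < 1) {f g h : ℝ → ℝ≥0∞} (hf : Measurable f)
    (hg : Measurable g) (hh : Measurable h) (hM : ⨆ x, f x ≠ ∞) (hN : ⨆ x, g x ≠ ∞)
    (H : ∀ x y, f x ^ (1 - t) * g y ^ t ≤ h ((1 - t) * x + t * y)) :
    (∫⁻ x, f x) ^ (1 - t) * (∫⁻ x, g x) ^ t ≤ ∫⁻ x, h x := by
  have ht1' : 0 < 1 - t := sub_pos.2 ht1
  set M := ⨆ x, f x with hMd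
  set N := ⨆ x, g x with hNd
  have fM : ∀ x, f x ≤ M := fun x => le_iSup f x
  have gN : ∀ x, g x ≤ N := fun x => le_iSup g x
  by_cases M0 : M = 0
  · have : ∀ x, f x = 0 := fun x => le_antisymm (M0 ▸ fM x) bot_le
    simp [this, ht1']
  by_cases N0 : N = 0
  · have : ∀ x, g x = 0 := fun x => le_antisymm (N0 ▸ gN x) bot_le
    simp [this, ht0]
  set D := M ^ (1 - t) * N ^ t with hD
  have D0 : D ≠ 0 := by simp [hD, M0, N0, hM, hN]
  have Dt : D ≠ ∞ := by
    apply ENNReal.mul_ne_top <;> apply ENNReal.rpow_ne_top_of_nonneg <;> first | assumption | linarith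
  have key := pl1_norm ht0 ht1 (f := fun x => (f x / M).toReal) (g := fun x => (g x / N).toReal)
    (h := fun x => (min (h x / D) 1).toReal) (by fun_prop) (by fun_prop) (by fun_prop)
    (fun _ => ENNReal.toReal_nonneg) (fun _ => ENNReal.toReal_nonneg)
    (fun _ => ENNReal.toReal_nonneg)
    (fun x => ENNReal.toReal_mono ENNReal.one_ne_top (ENNReal.div_le_of_le_mul (by simpa using fM x)))
    (fun x => ENNReal.toReal_mono ENNReal.one_ne_top (ENNReal.div_le_of_le_mul (by simpa using gN x)))
    ?_ ?_ ?_
  · have ef : ∀ x, ENNReal.ofReal (f x / M).toReal = f x / M := fun x =>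
      ENNReal.ofReal_toReal (ENNReal.div_ne_top (ne_top_of_le_ne_top hM (fM x)) M0)
    have eg : ∀ x, ENNReal.ofReal (g x / N).toReal = g x / N := fun x =>
      ENNReal.ofReal_toReal (ENNReal.div_ne_top (ne_top_of_le_ne_top hN (gN x)) N0)
    have eh : ∀ x, ENNReal.ofReal (min (h x / D) 1).toReal ≤ h x / D := fun x =>
      ENNReal.ofReal_toReal_le.trans (min_le_left _ _)
    simp only [ef, eg] at key
    have key2 := key.trans (lintegral_mono eh)
    simp only [ENNReal.div_eq_inv_mul] at key2
    rw [lintegral_const_mul _ hf, lintegral_const_mul _ hg, lintegral_const_mul _ hh] at key2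
    have key3 := (ennreal_amgm ht0 ht1 _ _).trans key2
    rw [ENNReal.mul_rpow_of_nonneg _ _ ht1'.le, ENNReal.mul_rpow_of_nonneg _ _ ht0.le,
      ENNReal.inv_rpow, ENNReal.inv_rpow, mul_mul_mul_comm, ← ENNReal.mul_inv, ← hD] at key3
    · rwa [ENNReal.mul_le_mul_iff_right (ENNReal.inv_ne_zero.2 Dt) (ENNReal.inv_ne_top.2 D0)] at key3
    · left; simp [M0, hM]
    · right; simp [N0, hN]
  · intro c hc0 hc
    have : ENNReal.ofReal c * M < M := by
      nth_rw 2 [← one_mul M]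
      exact ENNReal.mul_lt_mul_left M0 hM (by simpa using hc)
    obtain ⟨x, hx⟩ := lt_iSup_iff.1 this
    refine ⟨x, ?_⟩
    rw [← ENNReal.ofReal_lt_iff_lt_toReal hc0
      (ENNReal.div_ne_top (ne_top_of_le_ne_top hM (fM x)) M0)]
    exact (ENNReal.lt_div_iff_mul_lt (Or.inl M0) (Or.inl hM)).2 hx
  · intro c hc0 hc
    have : ENNReal.ofReal c * N < N := by
      nth_rw 2 [← one_mul N]
      exact ENNReal.mul_lt_mul_left N0 hN (by simpa using hc)
    obtain ⟨x, hx⟩ := lt_iSup_iff.1 this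
    refine ⟨x, ?_⟩
    rw [← ENNReal.ofReal_lt_iff_lt_toReal hc0
      (ENNReal.div_ne_top (ne_top_of_le_ne_top hN (gN x)) N0)]
    exact (ENNReal.lt_div_iff_mul_lt (Or.inl N0) (Or.inl hN)).2 hx
  · intro x y c hc0 h1 h2
    have hfM : f x / M ≤ 1 := ENNReal.div_le_of_le_mul (by simpa using fM x)
    have hgN : g y / N ≤ 1 := ENNReal.div_le_of_le_mul (by simpa using gN y)
    rw [← ENNReal.ofReal_lt_iff_lt_toReal hc0 (ne_top_of_le_ne_top ENNReal.one_ne_top hfM)] at h1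
    rw [← ENNReal.ofReal_lt_iff_lt_toReal hc0 (ne_top_of_le_ne_top ENNReal.one_ne_top hgN)] at h2
    rw [← ENNReal.ofReal_lt_iff_lt_toReal hc0
      (ne_top_of_le_ne_top ENNReal.one_ne_top (min_le_right _ _))]
    refine lt_min ?_ (h1.trans_le hfM)
    refine (lt_min h1 h2).trans_le ((min_le_geom ht0 ht1 _ _).trans ?_)
    have : (f x / M) ^ (1 - t) * (g y / N) ^ t = (f x ^ (1 - t) * g y ^ t) / D := by
      simp only [ENNReal.div_eq_inv_mul]
      rw [ENNReal.mul_rpow_of_nonneg _ _ ht1'.le, ENNReal.mul_rpow_of_nonneg _ _ ht0.le,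
        ENNReal.inv_rpow, ENNReal.inv_rpow, mul_mul_mul_comm, ← ENNReal.mul_inv, ← hD]
      · left; simp [M0, hM]
      · right; simp [N0, hN]
    rw [this]
    gcongr
    exact H x y

/-- The Prékopa–Leindler property of a measure. -/
def PLProp {E : Type*} [AddCommGroup E] [Module ℝ E] [MeasurableSpace E] (μ : Measure E) : Prop :=
  ∀ (t : ℝ), 0 < t → t < 1 → ∀ f g h : E → ℝ≥0∞, Measurable f → Measurable g → Measurable h →
    (∀ x y, f x ^ (1 - t) * g y ^ t ≤ h ((1 - t) • x + t • y)) →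
    (∫⁻ x, f x ∂μ) ^ (1 - t) * (∫⁻ x, g x ∂μ) ^ t ≤ ∫⁻ x, h x ∂μ

theorem pl_real : PLProp (volume : Measure ℝ) := by
  intro t ht0 ht1 f g h hf hg hh H
  have ht1' : 0 < 1 - t := sub_pos.2 ht1
  by_cases a0 : ∫⁻ x, f x = 0
  · simp [a0, ht1']
  by_cases b0 : ∫⁻ x, g x = 0
  · simp [b0, ht0]
  have lim : ∀ {F : ℝ → ℝ≥0∞}, Measurable F →
      Tendsto (fun k : ℕ => ∫⁻ x, min (F x) k) atTop (𝓝 (∫⁻ x, F x)) := by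
    intro F hF
    refine lintegral_tendsto_of_tendsto_of_monotone (fun k => by fun_prop) ?_ ?_
    · refine ae_of_all _ fun x k l hkl => ?_
      exact min_le_min le_rfl (by exact_mod_cast hkl)
    · refine ae_of_all _ fun x => ?_
      have : Tendsto (fun k : ℕ => min (F x) (k : ℝ≥0∞)) atTop (𝓝 (min (F x) ∞)) :=
        tendsto_const_nhds.min ENNReal.tendsto_nat_nhds_top
      simpa using this
  have T : Tendsto (fun k : ℕ => (∫⁻ x, min (f x) k) ^ (1 - t) * (∫⁻ x, min (g x) k) ^ t) atTop
      (𝓝 ((∫⁻ x, f x) ^ (1 - t) * (∫⁻ x, g x) ^ t)) := by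
    refine ENNReal.Tendsto.mul ((ENNReal.continuous_rpow_const.tendsto _).comp (lim hf)) (Or.inl ?_)
      ((ENNReal.continuous_rpow_const.tendsto _).comp (lim hg)) (Or.inl ?_)
    · simp [ENNReal.rpow_eq_zero_iff, a0, ht1.le]
    · simp [ENNReal.rpow_eq_zero_iff, b0, ht0.le]
  refine le_of_tendsto T (Eventually.of_forall fun k => ?_)
  refine pl1_bdd ht0 ht1 (by fun_prop) (by fun_prop) hh ?_ ?_ fun x y => ?_
  · exact ne_top_of_le_ne_top (ENNReal.natCast_ne_top k) (iSup_le fun x => min_le_right _ _)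
  · exact ne_top_of_le_ne_top (ENNReal.natCast_ne_top k) (iSup_le fun x => min_le_right _ _)
  · refine le_trans ?_ (H x y)
    gcongr <;> exact min_le_left _ _

theorem pl_prod {E F : Type*} [AddCommGroup E] [Module ℝ E] [MeasurableSpace E]
    [AddCommGroup F] [Module ℝ F] [MeasurableSpace F] {μ : Measure E} {ν : Measure F}
    [SFinite μ] [SFinite ν] (h1 : PLProp μ) (h2 : PLProp ν) : PLProp (μ.prod ν) := by
  intro t ht0 ht1 f g h hf hg hh H
  rw [lintegral_prod _ hf.aemeasurable, lintegral_prod _ hg.aemeasurable,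
    lintegral_prod _ hh.aemeasurable]
  refine h1 t ht0 ht1 _ _ _ hf.lintegral_prod_right' hg.lintegral_prod_right'
    hh.lintegral_prod_right' fun x y => ?_
  refine h2 t ht0 ht1 _ _ _ (by fun_prop) (by fun_prop) (by fun_prop) fun z w => ?_
  exact H (x, z) (y, w)

theorem pl_equiv {E F : Type*} [AddCommGroup E] [Module ℝ E] [MeasurableSpace E]
    [AddCommGroup F] [Module ℝ F] [MeasurableSpace F] {μ : Measure E} {ν : Measure F}
    (e : E → F) (he : MeasurePreserving e μ ν)
    (hl : ∀ (a b : ℝ) (x y : E), e (a • x + b • y) = a • e x + b • e y)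
    (h1 : PLProp μ) : PLProp ν := by
  intro t ht0 ht1 f g h hf hg hh H
  rw [← he.lintegral_comp hf, ← he.lintegral_comp hg, ← he.lintegral_comp hh]
  refine h1 t ht0 ht1 _ _ _ (hf.comp he.measurable) (hg.comp he.measurable)
    (hh.comp he.measurable) fun x y => ?_
  rw [hl]
  exact H _ _

theorem pl_pi (n : ℕ) : PLProp (volume : Measure (Fin n → ℝ)) := by
  induction n with
  | zero =>
    intro t ht0 ht1 f g h hf hg hh H
    have := H default default
    have e : ∀ F : (Fin 0 → ℝ) → ℝ≥0∞, ∫⁻ x, F x = F default := by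
      intro F
      rw [volume_pi, Measure.pi_of_empty _ default, lintegral_dirac]
    rw [e, e, e]
    convert this using 2
  | succ n ih =>
    have := volume_preserving_piFinSuccAbove (fun _ : Fin (n + 1) => ℝ) 0
    refine pl_equiv _ this.symm ?_ (pl_prod pl_real ih)
    intro a b x y
    ext i
    refine Fin.cases ?_ (fun j => ?_) i <;> simp [MeasurableEquiv.piFinSuccAbove]

theorem pl_eu (n : ℕ) : PLProp (volume : Measure (Eu n)) := by
  refine pl_equiv _ (PiLp.volume_preserving_toLp (Fin n)) ?_ (pl_pi n)
  intro a b x y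
  simp


/-- unnormalised Gaussian density -/
def gD {n : ℕ} (x : Eu n) : ℝ := Real.exp (-‖x‖ ^ 2 / 2)

theorem gD_cont {n : ℕ} : Continuous (gD : Eu n → ℝ) := by
  unfold gD; fun_prop

theorem gD_pos {n : ℕ} (x : Eu n) : 0 < gD x := Real.exp_pos _

theorem gD_le_one {n : ℕ} (x : Eu n) : gD x ≤ 1 := by
  unfold gD
  rw [Real.exp_le_one_iff]
  have := sq_nonneg ‖x‖
  linarith

/-- unnormalised Gaussian measure -/
def gM (n : ℕ) : Measure (Eu n) := volume.withDensity fun x => ENNReal.ofReal (gD x)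

theorem gM_le (n : ℕ) (A : Set (Eu n)) (hA : MeasurableSet A) : gM n A ≤ volume A := by
  rw [gM, withDensity_apply _ hA]
  calc _ ≤ ∫⁻ x in A, 1 := lintegral_mono fun x => by
        rw [ENNReal.ofReal_le_one]; exact gD_le_one x
    _ = _ := by simp

theorem gM_pos_of_open {n : ℕ} {U : Set (Eu n)} (hU : IsOpen U) (hne : U.Nonempty) :
    0 < gM n U := by
  rw [gM, withDensity_apply _ hU.measurableSet]
  rw [setLIntegral_pos_iff (by have := gD_cont (n := n); fun_prop)]
  have : (Function.support fun x : Eu n => ENNReal.ofReal (gD x)) = univ := by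
    ext x; simp [gD_pos x]
  rw [this, univ_inter]
  exact hU.measure_pos _ hne

theorem gM_finite_of_compact {n : ℕ} {A K : Set (Eu n)} (hK : IsCompact K) (h : A ⊆ K) :
    gM n A ≠ ∞ :=
  ne_top_of_le_ne_top hK.measure_ne_top ((measure_mono h).trans (gM_le n K hK.measurableSet))

theorem gM_real_eq {n : ℕ} {A : Set (Eu n)} (hA : MeasurableSet A) :
    (gM n).real A = ∫ x in A, gD x := by
  rw [integral_eq_lintegral_of_nonneg_ae (ae_of_all _ fun x => (gD_pos x).le)
    gD_cont.aestronglyMeasurable, measureReal_def, gM, withDensity_apply _ hA]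

theorem gD_comb {n : ℕ} (t : ℝ) (x y : Eu n) :
    -‖(1 - t) • x + t • y‖ ^ 2 / 2 = (1 - t) * (-‖x‖ ^ 2 / 2) + t * (-‖y‖ ^ 2 / 2)
      + t * (1 - t) * ‖x - y‖ ^ 2 / 2 := by
  rw [norm_add_sq_real, norm_sub_sq_real, norm_smul, norm_smul, inner_smul_left, inner_smul_right,
    mul_pow, mul_pow, Real.norm_eq_abs, Real.norm_eq_abs, sq_abs, sq_abs]
  simp
  ring

theorem gM_pl {n : ℕ} {t : ℝ} (ht0 : 0 < t) (ht1 : t < 1) {A B C : Set (Eu n)}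
    (hA : MeasurableSet A) (hB : MeasurableSet B) (hC : MeasurableSet C) {δ : ℝ} (hδ : 0 ≤ δ)
    (hd : ∀ x ∈ A, ∀ y ∈ B, δ ≤ ‖x - y‖)
    (h : ∀ x ∈ A, ∀ y ∈ B, (1 - t) • x + t • y ∈ C) (hAB : gM n A = gM n B) :
    ENNReal.ofReal (Real.exp (t * (1 - t) * δ ^ 2 / 2)) * gM n A ≤ gM n C := by
  have ht1' : 0 < 1 - t := sub_pos.2 ht1
  have hgm : Measurable (fun x : Eu n => ENNReal.ofReal (gD x)) := by
    have := gD_cont (n := n); fun_prop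
  have key := pl_eu n t ht0 ht1
    (A.indicator fun x => ENNReal.ofReal (Real.exp (t * (1 - t) * δ ^ 2 / 2)) * ENNReal.ofReal (gD x))
    (B.indicator fun x => ENNReal.ofReal (Real.exp (t * (1 - t) * δ ^ 2 / 2)) * ENNReal.ofReal (gD x))
    (C.indicator fun x => ENNReal.ofReal (gD x))
    ((hgm.const_mul _).indicator hA) ((hgm.const_mul _).indicator hB) (hgm.indicator hC) ?_
  · rw [lintegral_indicator hA, lintegral_indicator hB, lintegral_indicator hC,
      lintegral_const_mul _ hgm, lintegral_const_mul _ hgm, ← withDensity_apply _ hA,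
      ← withDensity_apply _ hB, ← withDensity_apply _ hC] at key
    change (_ * gM n A) ^ (1 - t) * (_ * gM n B) ^ t ≤ gM n C at key
    rw [← hAB, ← ENNReal.rpow_add_of_nonneg _ _ ht1'.le ht0.le] at key
    simpa using key
  · intro x y
    by_cases hx : x ∈ A
    · by_cases hy : y ∈ B
      · rw [indicator_of_mem hx, indicator_of_mem hy, indicator_of_mem (h x hx y hy)]
        rw [← ENNReal.ofReal_mul (Real.exp_pos _).le, ← ENNReal.ofReal_mul (Real.exp_pos _).le]
        unfold gD
        rw [← Real.exp_add, ← Real.exp_add, ENNReal.ofReal_rpow_of_pos (Real.exp_pos _),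
          ENNReal.ofReal_rpow_of_pos (Real.exp_pos _), ← Real.exp_mul, ← Real.exp_mul,
          ← ENNReal.ofReal_mul (Real.exp_pos _).le, ← Real.exp_add]
        apply ENNReal.ofReal_le_ofReal
        rw [Real.exp_le_exp, gD_comb]
        have h1 : δ ^ 2 ≤ ‖x - y‖ ^ 2 := pow_le_pow_left₀ hδ (hd x hx y hy) 2
        have h2 : 0 ≤ t * (1 - t) := by positivity
        nlinarith [mul_le_mul_of_nonneg_left h1 h2]
      · simp [indicator_of_notMem hy, ht0]
    · simp [indicator_of_notMem hx, ht1']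

theorem hyperplane_null {n : ℕ} {v : Eu n} (hv : ‖v‖ = 1) (a : ℝ) :
    volume {x : Eu n | ⟪x, v⟫ = a} = 0 := by
  have e : {x : Eu n | ⟪x, v⟫ = a} =
      (fun x => x + (-a) • v) ⁻¹' ((LinearMap.ker (innerSL ℝ v).toLinearMap : Submodule ℝ (Eu n)) : Set (Eu n)) := by
    ext x
    simp only [mem_setOf_eq, mem_preimage, SetLike.mem_coe, LinearMap.mem_ker]
    change _ ↔ ⟪v, x + (-a) • v⟫ = 0
    rw [inner_add_right, inner_smul_right, real_inner_self_eq_norm_sq, hv, real_inner_comm]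
    constructor <;> intro h <;> linarith
  rw [e, measure_preimage_add_right]
  apply Measure.addHaar_submodule
  intro h
  have : v ∈ LinearMap.ker (innerSL ℝ v).toLinearMap := h ▸ Submodule.mem_top
  have h2 : ⟪v, v⟫ = 0 := this
  rw [real_inner_self_eq_norm_sq, hv] at h2
  norm_num at h2

theorem mass_cont {n : ℕ} {v : Eu n} (hv : ‖v‖ = 1) {K : Set (Eu n)} (hK : IsCompact K) :
    Continuous fun a => (gM n).real (K ∩ {x | a < ⟪x, v⟫}) := by
  have hm : ∀ a, MeasurableSet {x : Eu n | a < ⟪x, v⟫} := fun a =>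
    measurableSet_lt measurable_const (by fun_prop)
  have e : (fun a => (gM n).real (K ∩ {x | a < ⟪x, v⟫})) =
      fun a => ∫ x in K, ({x : Eu n | a < ⟪x, v⟫}.indicator gD) x := by
    ext a
    rw [gM_real_eq (hK.measurableSet.inter (hm a)), setIntegral_indicator (hm a)]
  rw [e, continuous_iff_continuousAt]
  intro a
  refine continuousAt_of_dominated (bound := fun _ => 1) (Eventually.of_forall fun b =>
    (gD_cont.measurable.indicator (hm b)).aestronglyMeasurable)
    (Eventually.of_forall fun b => ae_of_all _ fun x => ?_)
    (integrableOn_const (hs := hK.measure_ne_top)) ?_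
  · refine (norm_indicator_le_norm_self _ _).trans ?_
    rw [Real.norm_of_nonneg (gD_pos x).le]
    exact gD_le_one x
  · have : ∀ᵐ x : Eu n, ⟪x, v⟫ ≠ a := by
      have := hyperplane_null hv a
      simpa [ae_iff] using this
    filter_upwards [ae_restrict_of_ae this] with x hx
    rcases lt_or_gt_of_ne hx with h | h
    · refine ContinuousAt.congr (f := fun _ => 0) continuousAt_const ?_
      filter_upwards [lt_mem_nhds h] with b hb
      rw [indicator_of_notMem]
      simpa using hb.le
    · refine ContinuousAt.congr (f := fun _ => gD x) continuousAt_const ?_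
      filter_upwards [gt_mem_nhds h] with b hb
      rw [indicator_of_mem]
      simpa using hb

theorem exists_sep {n : ℕ} {K L : Set (Eu n)} (hK : IsConvexBody K) (hL : IsConvexBody L)
    (hK0 : (0 : Eu n) ∈ interior K) (hvol : gM n K = gM n L) (hne : K ≠ L) :
    ∃ (v : Eu n) (s b : ℝ), ‖v‖ = 1 ∧ (∀ x ∈ K, ⟪x, v⟫ ≤ s) ∧ s < b ∧ 0 < b ∧
      0 < gM n (L ∩ {x | b < ⟪x, v⟫}) := by
  obtain ⟨p, hpL, hpK⟩ : ∃ p, p ∈ interior L ∧ p ∉ K := by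
    by_contra! hcon
    have hLK : L ⊆ K := by
      rw [← hL.2.1.isClosed.closure_eq, ← hL.1.closure_interior_eq_closure_of_nonempty_interior hL.2.2]
      exact closure_minimal hcon hK.2.1.isClosed
    have h2 : (interior K \ L).Nonempty := by
      by_contra hh
      rw [not_nonempty_iff_eq_empty, diff_eq_empty] at hh
      apply hne (subset_antisymm _ hLK)
      rw [← hK.2.1.isClosed.closure_eq, ← hK.1.closure_interior_eq_closure_of_nonempty_interior hK.2.2]
      exact closure_minimal hh hL.2.1.isClosed
    have h3 : 0 < gM n (interior K \ L) :=
      gM_pos_of_open (isOpen_interior.sdiff hL.2.1.isClosed) h2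
    have h4 : gM n L + gM n (interior K \ L) ≤ gM n K := by
      rw [← measure_union disjoint_sdiff_right
        (isOpen_interior.sdiff hL.2.1.isClosed).measurableSet]
      exact measure_mono (union_subset hLK (diff_subset.trans interior_subset))
    rw [hvol] at h4
    have h5 : gM n L ≠ ∞ := gM_finite_of_compact hL.2.1 subset_rfl
    exact absurd h4 (not_le.2 (ENNReal.lt_add_right h5 h3.ne'))
  obtain ⟨f, u, hfu, hup⟩ := geometric_hahn_banach_closed_point hK.1 hK.2.1.isClosed hpK
  set w := (InnerProductSpace.toDual ℝ (Eu n)).symm f with hw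
  have fw : ∀ x, f x = ⟪x, w⟫ := fun x => by
    rw [real_inner_comm, hw, InnerProductSpace.toDual_symm_apply]
  have hu0 : 0 < u := by simpa using hfu 0 (interior_subset hK0)
  have hw0 : 0 < ‖w‖ := by
    rw [norm_pos_iff]
    rintro h0
    have := fw p
    rw [h0, inner_zero_right] at this
    linarith
  have inn : ∀ x, ⟪x, ‖w‖⁻¹ • w⟫ = f x / ‖w‖ := fun x => by
    rw [inner_smul_right, fw]; field_simp
  refine ⟨‖w‖⁻¹ • w, u / ‖w‖, (u + f p) / 2 / ‖w‖, ?_, ?_, ?_, ?_, ?_⟩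
  · rw [norm_smul]; simp [hw0.ne']
  · intro x hx
    rw [inn]
    gcongr
    exact (hfu x hx).le
  · gcongr; linarith
  · apply div_pos _ hw0; linarith
  · have ho : IsOpen (interior L ∩ {x | (u + f p) / 2 / ‖w‖ < ⟪x, ‖w‖⁻¹ • w⟫}) :=
      isOpen_interior.inter (isOpen_lt continuous_const (by fun_prop))
    refine (gM_pos_of_open ho ⟨p, hpL, ?_⟩).trans_le
      (measure_mono (inter_subset_inter_left _ interior_subset))
    simp only [mem_setOf_eq, inn]
    gcongr; linarith

theorem lower_bound {n : ℕ} {K L : Set (Eu n)} (hK : IsConvexBody K) (hL : IsConvexBody L)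
    (hK0 : (0 : Eu n) ∈ interior K) (hvol : gM n K = gM n L) (hne : K ≠ L) :
    ∃ δ m : ℝ, 0 < δ ∧ 0 < m ∧ ∀ t, 0 < t → t < 1 →
      (gM n).real K - m + Real.exp (t * (1 - t) * δ ^ 2 / 2) * m
        ≤ (gM n).real ((1 - t) • K + t • L) := by
  obtain ⟨v, s, b, hv, hs, hsb, hb0, hb⟩ := exists_sep hK hL hK0 hvol hne
  have fin : ∀ {A : Set (Eu n)}, A ⊆ K → gM n A ≠ ∞ := fun h => gM_finite_of_compact hK.2.1 h
  have finL : ∀ {A : Set (Eu n)}, A ⊆ L → gM n A ≠ ∞ := fun h => gM_finite_of_compact hL.2.1 h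
  have hm : ∀ a, MeasurableSet {x : Eu n | a < ⟪x, v⟫} := fun a =>
    measurableSet_lt measurable_const (by fun_prop)
  obtain ⟨R, hR⟩ := hK.2.1.isBounded.exists_norm_le
  -- choose the level `a`
  obtain ⟨a, ha⟩ : ∃ a, (gM n).real (K ∩ {x | a < ⟪x, v⟫}) = (gM n).real (L ∩ {x | b < ⟪x, v⟫}) := by
    have h1 : (gM n).real (K ∩ {x | s < ⟪x, v⟫}) ≤ (gM n).real (L ∩ {x | b < ⟪x, v⟫}) := by
      have : K ∩ {x | s < ⟪x, v⟫} = ∅ := by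
        ext x; simp only [mem_inter_iff, mem_setOf_eq, mem_empty_iff_false, iff_false, not_and, not_lt]
        exact hs x
      rw [this]; simp
    have h2 : (gM n).real (L ∩ {x | b < ⟪x, v⟫}) ≤ (gM n).real (K ∩ {x | -R - 1 < ⟪x, v⟫}) := by
      have : K ∩ {x | -R - 1 < ⟪x, v⟫} = K := by
        rw [inter_eq_left]
        intro x hx
        have := abs_real_inner_le_norm x v
        rw [hv, mul_one] at this
        have := (abs_le.1 (this.trans (hR x hx))).1
        simp only [mem_setOf_eq]; linarith
      rw [this, measureReal_def, measureReal_def, hvol]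
      exact ENNReal.toReal_mono (finL subset_rfl) (measure_mono inter_subset_left)
    obtain ⟨a, ha⟩ := mem_range_of_exists_le_of_exists_ge (mass_cont hv hK.2.1) ⟨s, h1⟩ ⟨_, h2⟩
    exact ⟨a, ha⟩
  set Kp := K ∩ {x | a < ⟪x, v⟫} with hKp
  set Lp := L ∩ {x | b < ⟪x, v⟫} with hLp
  have hKpm : MeasurableSet Kp := hK.2.1.measurableSet.inter (hm a)
  have hLpm : MeasurableSet Lp := hL.2.1.measurableSet.inter (hm b)
  have eqp : gM n Kp = gM n Lp := (measureReal_eq_measureReal_iff (fin inter_subset_left)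
    (finL inter_subset_left)).1 ha
  have eqm : gM n (K \ Kp) = gM n (L \ Lp) := by
    rw [measure_diff inter_subset_left hKpm.nullMeasurableSet (fin inter_subset_left),
      measure_diff inter_subset_left hLpm.nullMeasurableSet (finL inter_subset_left), hvol, eqp]
  have mpos : 0 < (gM n).real Lp := ENNReal.toReal_pos hb.ne' (finL inter_subset_left)
  refine ⟨b - s, (gM n).real Lp, sub_pos.2 hsb, mpos, fun t ht0 ht1 => ?_⟩
  have ht1' : 0 < 1 - t := sub_pos.2 ht1
  set C := (1 - t) • K + t • L with hC
  have hCc : IsCompact C := (hK.2.1.smul _).add (hL.2.1.smul _)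
  have memC : ∀ x ∈ K, ∀ y ∈ L, (1 - t) • x + t • y ∈ C := fun x hx y hy =>
    add_mem_add (smul_mem_smul_set hx) (smul_mem_smul_set hy)
  set c := (1 - t) * a + t * b with hc
  set Cp := C ∩ {x | c < ⟪x, v⟫} with hCp
  have hCpm : MeasurableSet Cp := hCc.measurableSet.inter (hm c)
  have inn : ∀ x y, ⟪(1 - t) • x + t • y, v⟫ = (1 - t) * ⟪x, v⟫ + t * ⟪y, v⟫ := fun x y => by
    rw [inner_add_left, inner_smul_left, inner_smul_left]; simp
  have k1 := gM_pl ht0 ht1 (δ := b - s) hKpm hLpm hCpm (sub_pos.2 hsb).le ?_ ?_ eqp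
  have k2 := gM_pl ht0 ht1 (δ := 0) (hK.2.1.measurableSet.diff hKpm)
    (hL.2.1.measurableSet.diff hLpm) (hCc.measurableSet.diff hCpm) le_rfl
    (fun _ _ _ _ => norm_nonneg _) ?_ eqm
  · have k1' := ENNReal.toReal_mono (gM_finite_of_compact hCc inter_subset_left) k1
    have k2' := ENNReal.toReal_mono (gM_finite_of_compact hCc diff_subset) k2
    rw [ENNReal.toReal_mul, ENNReal.toReal_ofReal (Real.exp_pos _).le] at k1' k2'
    simp only [← measureReal_def] at k1' k2'
    rw [ha] at k1'
    have d1 := measureReal_diff_add_inter (μ := gM n) (s := C) (t := Cp) hCpm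
      (gM_finite_of_compact hCc subset_rfl)
    have d2 := measureReal_diff_add_inter (μ := gM n) (s := K) (t := Kp) hKpm (fin subset_rfl)
    rw [inter_eq_right.2 inter_subset_left] at d1 d2
    rw [ha] at d2
    simp at k2'
    linarith
  · rintro x ⟨hx, hx'⟩ y ⟨hy, hy'⟩
    refine ⟨memC x hx y hy, fun h => ?_⟩
    have h1 : ⟪x, v⟫ ≤ a := not_lt.1 fun h => hx' ⟨hx, h⟩
    have h2 : ⟪y, v⟫ ≤ b := not_lt.1 fun h => hy' ⟨hy, h⟩
    have h3 : c < _ := h.2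
    rw [inn] at h3
    nlinarith [mul_le_mul_of_nonneg_left h1 ht1'.le, mul_le_mul_of_nonneg_left h2 ht0.le]
  · rintro x ⟨hx, hx'⟩ y ⟨hy, hy'⟩
    have h1 := hs x hx
    have h2 : b < _ := hy'
    have h3 := abs_real_inner_le_norm (y - x) v
    rw [hv, mul_one, norm_sub_rev, inner_sub_left] at h3
    have := le_abs_self (⟪y, v⟫ - ⟪x, v⟫)
    linarith
  · rintro x ⟨hx, hx'⟩ y ⟨hy, hy'⟩
    refine ⟨memC x hx y hy, ?_⟩
    have h1 : a < _ := hx'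
    have h2 : b < _ := hy'
    simp only [mem_setOf_eq, inn]
    nlinarith [mul_lt_mul_of_pos_left h1 ht1', mul_lt_mul_of_pos_left h2 ht0]


section gaugefacts
variable {n : ℕ} {K L : Set (Eu n)}

theorem nhds0 (hK0 : (0 : Eu n) ∈ interior K) : K ∈ 𝓝 (0 : Eu n) := mem_interior_iff_mem_nhds.1 hK0

theorem g_cont (hK : IsConvexBody K) (hK0 : (0 : Eu n) ∈ interior K) : Continuous (gauge K) :=
  continuous_gauge hK.1 (nhds0 hK0)

theorem g_le_one (hK : IsConvexBody K) (hK0 : (0 : Eu n) ∈ interior K) {x : Eu n} :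
    gauge K x ≤ 1 ↔ x ∈ K := by
  rw [gauge_le_one_iff_mem_closure hK.1 (nhds0 hK0), hK.2.1.isClosed.closure_eq]

theorem g_frontier (hK : IsConvexBody K) (hK0 : (0 : Eu n) ∈ interior K) {x : Eu n} :
    gauge K x = 1 ↔ x ∈ frontier K :=
  gauge_eq_one_iff_mem_frontier hK.1 (nhds0 hK0)

theorem g_pos (hK : IsConvexBody K) (hK0 : (0 : Eu n) ∈ interior K) {x : Eu n} (hx : x ≠ 0) :
    0 < gauge K x :=
  (gauge_pos (absorbent_nhds_zero (nhds0 hK0))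
    (NormedSpace.isVonNBounded_of_isBounded ℝ hK.2.1.isBounded)).2 hx

theorem g_smul {c : ℝ} (hc : 0 ≤ c) (x : Eu n) : gauge K (c • x) = c * gauge K x :=
  gauge_smul_of_nonneg hc x

/-- gradient of the gauge -/
def gp (K : Set (Eu n)) (x : Eu n) : Eu n :=
  (InnerProductSpace.toDual ℝ (Eu n)).symm (fderiv ℝ (gauge K) x)

theorem gp_inner (x y : Eu n) : ⟪y, gp K x⟫ = fderiv ℝ (gauge K) x y := by
  rw [real_inner_comm, gp, InnerProductSpace.toDual_symm_apply]

theorem gp_meas : Measurable (gp K) :=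
  (InnerProductSpace.toDual ℝ (Eu n)).symm.continuous.measurable.comp (measurable_fderiv ℝ _)

/-- points of differentiability of the gauge -/
def gDiff (K : Set (Eu n)) : Set (Eu n) := {x | DifferentiableAt ℝ (gauge K) x}

theorem gDiff_meas : MeasurableSet (gDiff K) := measurableSet_of_differentiableAt ℝ _

theorem gDiff_ae (hK : IsConvexBody K) (hK0 : (0 : Eu n) ∈ interior K) :
    volume (gDiff K)ᶜ = 0 := by
  obtain ⟨C, hC⟩ := hK.1.lipschitz_gauge (nhds0 hK0)
  exact hC.ae_differentiableAt (μ := volume)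

theorem gp_bdd (hK : IsConvexBody K) (hK0 : (0 : Eu n) ∈ interior K) :
    ∃ C : ℝ, ∀ x, ‖gp K x‖ ≤ C := by
  obtain ⟨C, hC⟩ := hK.1.lipschitz_gauge (nhds0 hK0)
  refine ⟨C, fun x => ?_⟩
  rw [gp, LinearIsometryEquiv.norm_map]
  exact norm_fderiv_le_of_lipschitz ℝ hC

theorem gDiff_smul {c : ℝ} (hc : 0 < c) {x : Eu n} (hx : x ∈ gDiff K) : c • x ∈ gDiff K := by
  have e : gauge K = fun y => c * gauge K (c⁻¹ • y) := by
    ext y; rw [← g_smul hc.le, smul_inv_smul₀ hc.ne']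
  have hx' : DifferentiableAt ℝ (gauge K) (c⁻¹ • c • x) := by
    rw [inv_smul_smul₀ hc.ne']; exact hx
  change DifferentiableAt ℝ (gauge K) (c • x)
  rw [e]
  exact (hx'.comp (c • x) (by fun_prop : DifferentiableAt ℝ (fun y : Eu n => c⁻¹ • y) (c • x))).const_mul c

theorem line_deriv {x : Eu n} (hx : x ∈ gDiff K) (y : Eu n) :
    HasDerivAt (fun t : ℝ => gauge K (x + t • y)) ⟪y, gp K x⟫ 0 := by
  rw [gp_inner]
  have h1 : HasFDerivAt (gauge K) (fderiv ℝ (gauge K) x) (x + (0 : ℝ) • y) := by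
    simpa using hx.hasFDerivAt
  have h2 : HasDerivAt (fun t : ℝ => x + t • y) y 0 := by
    simpa using ((hasDerivAt_id (0 : ℝ)).smul_const y).const_add x
  exact h1.comp_hasDerivAt (0 : ℝ) h2

theorem gp_le (hK : IsConvexBody K) (hK0 : (0 : Eu n) ∈ interior K) {x : Eu n}
    (hx : x ∈ gDiff K) (y : Eu n) : ⟪y, gp K x⟫ ≤ gauge K y := by
  have h := line_deriv hx y
  have h2 : HasDerivAt (fun t : ℝ => gauge K x + t * gauge K y) (gauge K y) 0 := by
    simpa using ((hasDerivAt_id (0 : ℝ)).mul_const (gauge K y)).const_add (gauge K x)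
  have t1 := h.tendsto_slope_zero_right
  have t2 := h2.tendsto_slope_zero_right
  refine le_of_tendsto_of_tendsto t1 t2 ?_
  filter_upwards [self_mem_nhdsWithin] with t ht
  have ht : 0 < t := ht
  simp only [zero_add, zero_smul, add_zero, zero_mul, smul_eq_mul]
  gcongr
  rw [← g_smul ht.le]
  exact gauge_add_le hK.1 (absorbent_nhds_zero (nhds0 hK0)) _ _

theorem gp_self {x : Eu n} (hx : x ∈ gDiff K) : ⟪x, gp K x⟫ = gauge K x := by
  have h := line_deriv hx x
  have h2 : HasDerivAt (fun t : ℝ => (1 + t) * gauge K x) (gauge K x) 0 := by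
    simpa using ((hasDerivAt_id (0 : ℝ)).const_add 1).mul_const (gauge K x)
  refine h.unique (h2.congr_of_eventuallyEq ?_)
  filter_upwards [lt_mem_nhds (show (-1 : ℝ) < 0 by norm_num)] with t ht
  rw [← g_smul (by linarith), add_smul, one_smul]

theorem le_supp (hK : IsConvexBody K) {x : Eu n} (hx : x ∈ K) (v : Eu n) : ⟪x, v⟫ ≤ suppFun K v :=
  le_csSup (hK.2.1.image (by fun_prop)).bddAbove (mem_image_of_mem _ hx)

theorem supp_le (hK : IsConvexBody K) {v : Eu n} {c : ℝ} (h : ∀ x ∈ K, ⟪x, v⟫ ≤ c) :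
    suppFun K v ≤ c := by
  apply csSup_le
  · exact (hK.2.2.mono interior_subset).image _
  · rintro _ ⟨x, hx, rfl⟩
    exact h x hx

theorem supp_cont (hK : IsConvexBody K) : Continuous (suppFun K) :=
  hK.2.1.continuous_sSup (f := fun v y => ⟪y, v⟫) (by fun_prop)

theorem supp_smul (hK : IsConvexBody K) {c : ℝ} (hc : 0 < c) (v : Eu n) :
    suppFun K (c • v) = c * suppFun K v := by
  apply le_antisymm
  · apply supp_le hK
    intro x hx
    rw [inner_smul_right]
    exact mul_le_mul_of_nonneg_left (le_supp hK hx v) hc.le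
  · rw [← le_div_iff₀' hc]
    apply supp_le hK
    intro x hx
    rw [le_div_iff₀' hc, ← inner_smul_right]
    exact le_supp hK hx _

theorem supp_lower (hK : IsConvexBody K) (hK0 : (0 : Eu n) ∈ interior K) :
    ∃ r, 0 < r ∧ ∀ v, r * ‖v‖ ≤ suppFun K v := by
  obtain ⟨r, hr, hrK⟩ := Metric.nhds_basis_closedBall.mem_iff.1 (nhds0 hK0)
  refine ⟨r, hr, fun v => ?_⟩
  by_cases hv : v = 0
  · subst hv
    simpa using le_supp hK (interior_subset hK0) 0
  · have hv' : 0 < ‖v‖ := norm_pos_iff.2 hv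
    have : (r * ‖v‖⁻¹) • v ∈ K := hrK (by
      rw [mem_closedBall, dist_zero_right, norm_smul, norm_mul, norm_inv, norm_norm,
        Real.norm_of_nonneg hr.le]
      field_simp; rfl)
    refine le_trans (le_of_eq ?_) (le_supp hK this v)
    rw [inner_smul_left, real_inner_self_eq_norm_sq]
    simp
    field_simp

theorem exists_normal (hK : IsConvexBody K) {x : Eu n}
    (hx : x ∈ frontier K) : ∃ v : Eu n, ‖v‖ = 1 ∧ ⟪x, v⟫ = suppFun K v := by
  have hxK : x ∈ K := hK.2.1.isClosed.frontier_subset hx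
  obtain ⟨f, hf⟩ := geometric_hahn_banach_open_point hK.1.interior isOpen_interior
    (x := x) hx.2
  set w := (InnerProductSpace.toDual ℝ (Eu n)).symm f with hw
  have fw : ∀ x, f x = ⟪x, w⟫ := fun x => by
    rw [real_inner_comm, hw, InnerProductSpace.toDual_symm_apply]
  obtain ⟨z, hz⟩ := hK.2.2
  have hw0 : 0 < ‖w‖ := by
    rw [norm_pos_iff]
    rintro h0
    have h1 := hf z hz
    rw [fw, fw, h0, inner_zero_right, inner_zero_right] at h1
    exact lt_irrefl _ h1
  have hle : ∀ y ∈ K, f y ≤ f x := by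
    have : K ⊆ closure (interior K) := by
      rw [hK.1.closure_interior_eq_closure_of_nonempty_interior ⟨z, hz⟩]
      exact subset_closure
    intro y hy
    exact le_on_closure (fun a ha => (hf a ha).le) f.continuous.continuousOn
      continuousOn_const (this hy)
  refine ⟨‖w‖⁻¹ • w, by rw [norm_smul]; simp [hw0.ne'], le_antisymm (le_supp hK hxK _) ?_⟩
  apply supp_le hK
  intro y hy
  rw [inner_smul_right, inner_smul_right, ← fw, ← fw]
  exact mul_le_mul_of_nonneg_left (hle y hy) (by positivity)

theorem gaussMap_spec (hK : IsConvexBody K) {x : Eu n} (hx : x ∈ frontier K) :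
    ‖gaussMap K x‖ = 1 ∧ ⟪x, gaussMap K x⟫ = suppFun K (gaussMap K x) := by
  have h := exists_normal hK hx
  rw [gaussMap, dif_pos h]
  exact h.choose_spec

theorem normal_eq (hK : IsConvexBody K) (hK0 : (0 : Eu n) ∈ interior K) {x : Eu n}
    (hx : x ∈ frontier K) (hd : x ∈ gDiff K) {w : Eu n}
    (hw : ⟪x, w⟫ = suppFun K w) : w = suppFun K w • gp K x := by
  have hg1 : gauge K x = 1 := (g_frontier hK hK0).2 hx
  have hmin : IsLocalMin (fun y => suppFun K w * gauge K y - ⟪w, y⟫) x := by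
    refine Filter.Eventually.of_forall fun y => ?_
    dsimp only
    rw [hg1, real_inner_comm, hw, mul_one, sub_self, sub_nonneg, real_inner_comm]
    by_cases hy : y = 0
    · simp [hy]
    have hp := g_pos hK hK0 hy
    have : (gauge K y)⁻¹ • y ∈ K := by
      rw [← g_le_one hK hK0, g_smul (by positivity), inv_mul_cancel₀ hp.ne']
    have := le_supp hK this w
    rwa [inner_smul_left, conj_trivial, inv_mul_le_iff₀ hp, mul_comm] at this
  have hd' : HasFDerivAt (gauge K) (fderiv ℝ (gauge K) x) x :=
    DifferentiableAt.hasFDerivAt hd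
  have h2 : HasFDerivAt (fun y => suppFun K w * gauge K y - ⟪w, y⟫)
      (suppFun K w • fderiv ℝ (gauge K) x - innerSL ℝ w) x :=
    (hd'.const_mul _).sub (innerSL ℝ w).hasFDerivAt
  have h3 := hmin.hasFDerivAt_eq_zero h2
  apply ext_inner_left ℝ
  intro y
  have h4 := DFunLike.congr_fun h3 y
  rw [inner_smul_right, gp_inner]
  simp at h4
  rw [real_inner_comm]
  linarith

end gaugefacts

section polar
variable {n : ℕ}

/-- measure on the sphere -/
abbrev sig (n : ℕ) : Measure (sphere (0 : Eu n) 1) := (volume : Measure (Eu n)).toSphere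

theorem polar (hn : 1 ≤ n) {F : Eu n → ℝ≥0∞} (hF : Measurable F) :
    ∫⁻ x, F x = ∫⁻ u : sphere (0 : Eu n) 1, ∫⁻ r in Ioi (0 : ℝ),
      ENNReal.ofReal (r ^ (n - 1)) * F (r • (u : Eu n)) ∂volume ∂(sig n) := by
  haveI : Nonempty (Fin n) := ⟨⟨0, hn⟩⟩
  have hmp := (volume : Measure (Eu n)).measurePreserving_homeomorphUnitSphereProd
  calc ∫⁻ x, F x = ∫⁻ x : ({0}ᶜ : Set (Eu n)), F x
        ∂(Measure.comap (Subtype.val : ({0}ᶜ : Set (Eu n)) → Eu n) volume) := by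
        rw [lintegral_subtype_comap (measurableSet_singleton _).compl,
          restrict_compl_singleton]
    _ = ∫⁻ z : sphere (0 : Eu n) 1 × Ioi (0 : ℝ), F ((z.2 : ℝ) • (z.1 : Eu n))
        ∂((sig n).prod (.volumeIoiPow (Module.finrank ℝ (Eu n) - 1))) := by
        rw [← hmp.lintegral_comp (by fun_prop)]
        refine lintegral_congr fun x => ?_
        have := (homeomorphUnitSphereProd (Eu n)).symm_apply_apply x
        congr 1
        conv_lhs => rw [← this]
        rfl
    _ = _ := by
        rw [lintegral_prod _ (by fun_prop)]
        refine lintegral_congr fun u => ?_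
        simp only [Measure.volumeIoiPow]
        rw [lintegral_withDensity_eq_lintegral_mul _ (by fun_prop) (by fun_prop)]
        rw [← lintegral_subtype_comap measurableSet_Ioi]
        simp

end polar


section derivative

theorem integrable_of_bdd' {Ω : Type*} [MeasurableSpace Ω] {σ : Measure Ω} [IsFiniteMeasure σ]
    {f : Ω → ℝ} (hf : Measurable f) {C : ℝ} (h : ∀ u, |f u| ≤ C) : Integrable f σ :=
  Integrable.of_bound hf.aestronglyMeasurable C (ae_of_all _ h)

theorem param_deriv {Ω : Type*} [MeasurableSpace Ω] (σ : Measure Ω) [IsFiniteMeasure σ]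
    {ρ q : Ω → ℝ} (hρ : Measurable ρ) (hq : Measurable q) {A B : ℝ}
    (hA : ∀ u, |ρ u| ≤ A) (hB : ∀ u, |q u - 1| ≤ B) {φ : ℝ → ℝ} (hφ : Continuous φ) :
    (∀ t ∈ Icc (0 : ℝ) 1, Integrable (fun u => ∫ r in (0 : ℝ)..(ρ u * (1 + t * (q u - 1))), φ r) σ) ∧
    HasDerivAt (fun t => ∫ u, (∫ r in (0 : ℝ)..(ρ u * (1 + t * (q u - 1))), φ r) ∂σ)
      (∫ u, φ (ρ u) * (ρ u * (q u - 1)) ∂σ) 0 := by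
  set J : ℝ → ℝ := fun R => ∫ r in (0 : ℝ)..R, φ r with hJ
  have hJd : ∀ R, HasDerivAt J (φ R) R := fun R =>
    intervalIntegral.integral_hasDerivAt_right (hφ.intervalIntegrable _ _)
      (hφ.stronglyMeasurableAtFilter _ _) hφ.continuousAt
  have hJc : Continuous J := continuous_iff_continuousAt.2 fun R => (hJd R).continuousAt
  by_cases hne : Nonempty Ω
  swap
  · rw [not_nonempty_iff] at hne
    refine ⟨fun t _ => by simp [Measure.eq_zero_of_isEmpty σ], ?_⟩
    simp only [Measure.eq_zero_of_isEmpty σ, integral_zero_measure]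
    exact hasDerivAt_const _ _
  obtain ⟨u0⟩ := hne
  have hA0 : 0 ≤ A := (abs_nonneg _).trans (hA u0)
  have hB0 : 0 ≤ B := (abs_nonneg _).trans (hB u0)
  set M := A * (1 + 1 * B) with hM
  have harg : ∀ t ∈ Icc (-1 : ℝ) 1, ∀ u, ρ u * (1 + t * (q u - 1)) ∈ Icc (-M) M := by
    intro t ht u
    rw [mem_Icc, ← abs_le, abs_mul, hM]
    gcongr
    · exact hA u
    · refine (abs_add_le _ _).trans ?_
      rw [abs_one, abs_mul]
      gcongr
      · exact abs_le.2 ht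
      · exact hB u
  obtain ⟨C1, hC1⟩ := (isCompact_Icc (a := -M) (b := M)).exists_bound_of_continuousOn hJc.continuousOn
  obtain ⟨C2, hC2⟩ := (isCompact_Icc (a := -M) (b := M)).exists_bound_of_continuousOn hφ.continuousOn
  have hmeas : ∀ t : ℝ, Measurable fun u => J (ρ u * (1 + t * (q u - 1))) := fun t =>
    hJc.measurable.comp (by fun_prop)
  have hIntg : ∀ t ∈ Icc (-1 : ℝ) 1, Integrable (fun u => J (ρ u * (1 + t * (q u - 1)))) σ :=
    fun t ht => integrable_of_bdd' (hmeas t) fun u => hC1 _ (harg t ht u)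
  refine ⟨fun t ht => hIntg t ⟨by linarith [ht.1], ht.2⟩, ?_⟩
  have key := hasDerivAt_integral_of_dominated_loc_of_deriv_le (μ := σ) (𝕜 := ℝ)
    (F := fun t u => J (ρ u * (1 + t * (q u - 1))))
    (F' := fun t u => φ (ρ u * (1 + t * (q u - 1))) * (ρ u * (q u - 1)))
    (x₀ := 0) (s := Icc (-1) 1) (bound := fun _ => C2 * (A * B))
    (Icc_mem_nhds (by norm_num) (by norm_num))
    (Eventually.of_forall fun t => (hmeas t).aestronglyMeasurable)
    (hIntg 0 (by norm_num)) ?_ ?_ (integrable_const _) ?_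
  · simpa using key.2
  · have := hφ.measurable
    exact Measurable.aestronglyMeasurable (by fun_prop)
  · refine ae_of_all _ fun u t ht => ?_
    have h1 := hC2 _ (harg t ht u)
    rw [norm_mul]
    have : (0 : ℝ) ≤ C2 := (norm_nonneg _).trans h1
    gcongr
    rw [Real.norm_eq_abs, abs_mul]
    gcongr
    exacts [hA u, hB u]
  · refine ae_of_all _ fun u t ht => ?_
    have h1 : HasDerivAt (fun t : ℝ => ρ u * (1 + t * (q u - 1))) (ρ u * (q u - 1)) t := by
      simpa using (((hasDerivAt_id t).mul_const (q u - 1)).const_add 1).const_mul (ρ u)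
    exact (hJd _).comp t h1

theorem deriv_pos_aux {G : ℝ → ℝ} {G' c d m : ℝ} (hd : 0 < d) (hm : 0 < m)
    (hG : HasDerivAt G G' 0) (h0 : G 0 = c)
    (h : ∀ t, 0 < t → t < 1 → c - m + Real.exp (t * (1 - t) * d) * m ≤ G t) : 0 < G' := by
  have h1 : HasDerivAt (fun t : ℝ => t * (1 - t) * d) d 0 := by
    have := ((hasDerivAt_id (0 : ℝ)).mul ((hasDerivAt_id (0 : ℝ)).const_sub 1)).mul_const d
    simpa using this
  have h2 : HasDerivAt (fun t : ℝ => c - m + Real.exp (t * (1 - t) * d) * m) (d * m) 0 := by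
    simpa using (h1.exp.mul_const m).const_add (c - m)
  have t1 := hG.tendsto_slope_zero_right
  have t2 := h2.tendsto_slope_zero_right
  have : d * m ≤ G' := by
    refine le_of_tendsto_of_tendsto t2 t1 ?_
    filter_upwards [self_mem_nhdsWithin, mem_nhdsWithin_of_mem_nhds (gt_mem_nhds (show (0:ℝ) < 1 by norm_num))] with t ht ht1
    have ht : 0 < t := ht
    have := h t ht ht1
    simp only [zero_add, zero_mul, Real.exp_zero, smul_eq_mul, h0]
    gcongr
    linarith
  exact lt_of_lt_of_le (by positivity) this

variable {n : ℕ} {K L : Set (Eu n)}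

/-- boundary point in direction `u` -/
def bpt (K : Set (Eu n)) (u : Eu n) : Eu n := (gauge K u)⁻¹ • u

theorem bpt_meas (hK : IsConvexBody K) (hK0 : (0 : Eu n) ∈ interior K) : Measurable (bpt K) := by
  have := (g_cont hK hK0).measurable
  unfold bpt
  fun_prop

theorem bpt_frontier (hK : IsConvexBody K) (hK0 : (0 : Eu n) ∈ interior K) {u : Eu n}
    (hu : u ≠ 0) : bpt K u ∈ frontier K := by
  have := g_pos hK hK0 hu
  rw [← g_frontier hK hK0, bpt, g_smul (by positivity), inv_mul_cancel₀ this.ne']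

theorem sph_ne (u : sphere (0 : Eu n) 1) : (u : Eu n) ≠ 0 := by
  have := norm_eq_of_mem_sphere u
  intro h; rw [h] at this; simp at this

theorem rho_bdd (hK : IsConvexBody K) (hK0 : (0 : Eu n) ∈ interior K) :
    ∃ R : ℝ, ∀ u : sphere (0 : Eu n) 1, |(gauge K (u : Eu n))⁻¹| ≤ R := by
  obtain ⟨R, hR⟩ := hK.2.1.isBounded.exists_norm_le
  refine ⟨R, fun u => ?_⟩
  have := hR _ (hK.2.1.isClosed.frontier_subset (bpt_frontier hK hK0 (sph_ne u)))
  rwa [bpt, norm_smul, norm_eq_of_mem_sphere u, mul_one] at this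

theorem q_bdd (hK : IsConvexBody K) (hL : IsConvexBody L) (hK0 : (0 : Eu n) ∈ interior K) :
    ∃ B : ℝ, ∀ x, |suppFun L (gp K x) - 1| ≤ B := by
  obtain ⟨C, hC⟩ := gp_bdd hK hK0
  obtain ⟨B, hB⟩ := (isCompact_closedBall (0 : Eu n) C).exists_bound_of_continuousOn
    (f := fun v => suppFun L v - 1) ((supp_cont hL).sub continuous_const).continuousOn
  exact ⟨B, fun x => hB _ (by simpa using hC x)⟩

theorem ae_gDiff (hn : 1 ≤ n) (hK : IsConvexBody K) (hK0 : (0 : Eu n) ∈ interior K) :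
    ∀ᵐ u : sphere (0 : Eu n) 1 ∂(sig n), bpt K (u : Eu n) ∈ gDiff K := by
  have h := polar hn (F := (gDiff K)ᶜ.indicator 1) (measurable_one.indicator gDiff_meas.compl)
  rw [lintegral_indicator_one gDiff_meas.compl, gDiff_ae hK hK0] at h
  have hm : Measurable fun u : sphere (0 : Eu n) 1 => ∫⁻ r in Ioi (0 : ℝ),
      ENNReal.ofReal (r ^ (n - 1)) * ((gDiff K)ᶜ.indicator 1 (r • (u : Eu n)) : ℝ≥0∞) := by
    apply Measurable.lintegral_prod_right (f := fun (u : sphere (0 : Eu n) 1) (r : ℝ) =>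
      ENNReal.ofReal (r ^ (n - 1)) * ((gDiff K)ᶜ.indicator 1 (r • (u : Eu n)) : ℝ≥0∞))
    have : Measurable ((gDiff K)ᶜ.indicator (1 : Eu n → ℝ≥0∞)) :=
      measurable_one.indicator gDiff_meas.compl
    fun_prop
  have h2 := (lintegral_eq_zero_iff hm).1 h.symm
  filter_upwards [h2] with u hu
  by_contra hcon
  have hg := g_pos hK hK0 (sph_ne u)
  have hr : ∀ r : ℝ, 0 < r → r • (u : Eu n) ∈ (gDiff K)ᶜ := by
    intro r hr hd
    apply hcon
    have := gDiff_smul (c := (gauge K (u : Eu n))⁻¹ * r⁻¹) (by positivity) hd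
    rwa [smul_smul, mul_assoc, inv_mul_cancel₀ hr.ne', mul_one] at this
  have hu' : ∫⁻ r in Ioi (0 : ℝ), ENNReal.ofReal (r ^ (n - 1)) = 0 := by
    refine Eq.trans ?_ hu
    refine setLIntegral_congr_fun measurableSet_Ioi fun r hr' => ?_
    simp [indicator_of_mem (hr r hr')]
  have hfin := setLIntegral_pos_iff (μ := volume) (s := Ioi (0 : ℝ))
    (f := fun r : ℝ => ENNReal.ofReal (r ^ (n - 1))) (by fun_prop)
  rw [hu'] at hfin
  have : (Function.support fun r : ℝ => ENNReal.ofReal (r ^ (n - 1))) ∩ Ioi (0 : ℝ) = Ioi 0 := by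
    apply inter_eq_right.2
    intro r hr
    have hr : 0 < r := hr
    simp
    positivity
  rw [this] at hfin
  simp at hfin

/-- radial weight -/
def phi (n : ℕ) (r : ℝ) : ℝ := r ^ (n - 1) * Real.exp (-r ^ 2 / 2)

theorem phi_cont (n : ℕ) : Continuous (phi n) := by unfold phi; fun_prop

theorem phi_gD {u : sphere (0 : Eu n) 1} {r : ℝ} (hr : 0 < r) :
    ENNReal.ofReal (r ^ (n - 1)) * ENNReal.ofReal (gD (r • (u : Eu n))) = ENNReal.ofReal (phi n r) := by
  rw [← ENNReal.ofReal_mul (by positivity), gD, norm_smul, norm_eq_of_mem_sphere u, mul_one, phi]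
  simp

theorem phi_int {R : ℝ} (hR : 0 ≤ R) :
    ∫⁻ r in Ioc 0 R, ENNReal.ofReal (phi n r) = ENNReal.ofReal (∫ r in (0 : ℝ)..R, phi n r) := by
  rw [intervalIntegral.integral_of_le hR, ofReal_integral_eq_lintegral_ofReal]
  · exact ((phi_cont n).intervalIntegrable 0 R).1
  · filter_upwards [ae_restrict_mem measurableSet_Ioc] with r hr
    have := hr.1
    unfold phi
    positivity

theorem gM_polar (hn : 1 ≤ n) {A : Set (Eu n)} (hA : MeasurableSet A) :
    gM n A = ∫⁻ u : sphere (0 : Eu n) 1, ∫⁻ r in Ioi (0 : ℝ),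
      {r : ℝ | r • (u : Eu n) ∈ A}.indicator (fun r => ENNReal.ofReal (phi n r)) r ∂volume ∂(sig n) := by
  have hm : Measurable fun x : Eu n => ENNReal.ofReal (gD x) := by
    have := gD_cont (n := n); fun_prop
  rw [gM, withDensity_apply _ hA, ← lintegral_indicator hA, polar hn (hm.indicator hA)]
  refine lintegral_congr fun u => setLIntegral_congr_fun measurableSet_Ioi fun r hr => ?_
  by_cases h : r • (u : Eu n) ∈ A
  · rw [indicator_of_mem h, indicator_of_mem (by exact h), phi_gD hr]
  · rw [indicator_of_notMem h, indicator_of_notMem (by exact h), mul_zero]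

theorem gM_K (hn : 1 ≤ n) (hK : IsConvexBody K) (hK0 : (0 : Eu n) ∈ interior K) :
    gM n K = ∫⁻ u : sphere (0 : Eu n) 1, ENNReal.ofReal (∫ r in (0 : ℝ)..(gauge K (u : Eu n))⁻¹, phi n r) ∂(sig n) := by
  rw [gM_polar hn hK.2.1.measurableSet]
  refine lintegral_congr fun u => ?_
  have hg := g_pos hK hK0 (sph_ne u)
  rw [← phi_int (by positivity)]
  have e : {r : ℝ | r • (u : Eu n) ∈ K} ∩ Ioi 0 = Ioc 0 (gauge K (u : Eu n))⁻¹ := by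
    ext r
    simp only [mem_inter_iff, mem_Ioc, mem_Ioi]
    rw [and_comm]
    refine and_congr_right fun hr => ?_
    change r • (u : Eu n) ∈ K ↔ _
    rw [← g_le_one hK hK0, g_smul hr.le, ← one_div, le_div_iff₀ hg]
  have hm : MeasurableSet {r : ℝ | r • (u : Eu n) ∈ K} :=
    (hK.2.1.isClosed.preimage (f := fun r : ℝ => r • (u : Eu n)) (by fun_prop)).measurableSet
  rw [setLIntegral_indicator hm, e]

theorem gM_Kt (hn : 1 ≤ n) (hK : IsConvexBody K) (hL : IsConvexBody L)
    (hK0 : (0 : Eu n) ∈ interior K) (hL0 : (0 : Eu n) ∈ interior L) {t : ℝ} (ht0 : 0 < t) (ht1 : t < 1) :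
    gM n ((1 - t) • K + t • L) ≤ ∫⁻ u : sphere (0 : Eu n) 1, ENNReal.ofReal
      (∫ r in (0 : ℝ)..((gauge K (u : Eu n))⁻¹ * (1 + t * (suppFun L (gp K (bpt K u)) - 1))), phi n r) ∂(sig n) := by
  have hc : IsCompact ((1 - t) • K + t • L) := (hK.2.1.smul _).add (hL.2.1.smul _)
  rw [gM_polar hn hc.measurableSet]
  refine lintegral_mono_ae ?_
  filter_upwards [ae_gDiff hn hK hK0] with u hu
  have hg := g_pos hK hK0 (sph_ne u)
  have hq : 0 ≤ suppFun L (gp K (bpt K u)) := by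
    simpa using le_supp hL (interior_subset hL0) (gp K (bpt K u))
  rw [← phi_int (mul_nonneg (by positivity) (by nlinarith)), ← lintegral_indicator measurableSet_Ioi,
    ← lintegral_indicator measurableSet_Ioc]
  refine lintegral_mono fun r => ?_
  by_cases h : 0 < r ∧ r • (u : Eu n) ∈ (1 - t) • K + t • L
  swap
  · rw [indicator_apply]
    split_ifs with h1
    · rw [indicator_of_notMem (by intro h2; exact h ⟨h1, h2⟩)]; exact zero_le
    · exact zero_le
  · obtain ⟨hr, h⟩ := h
    rw [indicator_of_mem (by exact hr), indicator_of_mem (by exact h), indicator_of_mem]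
    refine ⟨hr, ?_⟩
    obtain ⟨_, ⟨k, hk, rfl⟩, _, ⟨l, hl, rfl⟩, he⟩ := h
    have e1 : ⟪(u : Eu n), gp K (bpt K u)⟫ = gauge K (u : Eu n) := by
      have := gp_self hu
      rw [(g_frontier hK hK0).2 (bpt_frontier hK hK0 (sph_ne u))] at this
      nth_rewrite 1 [bpt] at this
      rw [inner_smul_left, conj_trivial, inv_mul_eq_one₀ hg.ne'] at this
      exact this.symm
    have e2 : r * gauge K (u : Eu n) = (1 - t) * ⟪k, gp K (bpt K u)⟫ + t * ⟪l, gp K (bpt K u)⟫ := by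
      rw [← e1, ← conj_trivial r, ← inner_smul_left]
      simp only at he
      rw [← he, inner_add_left, inner_smul_left, inner_smul_left]
      simp
    have e3 : ⟪k, gp K (bpt K u)⟫ ≤ 1 := (gp_le hK hK0 hu k).trans ((g_le_one hK hK0).2 hk)
    have e4 := le_supp hL hl (gp K (bpt K u))
    rw [inv_mul_eq_div, le_div_iff₀ hg, e2]
    nlinarith

theorem deriv_pos (hn : 1 ≤ n) (hK : IsConvexBody K) (hL : IsConvexBody L)
    (hK0 : (0 : Eu n) ∈ interior K) (hL0 : (0 : Eu n) ∈ interior L)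
    (hvol : gM n K = gM n L) (hne : K ≠ L) :
    0 < ∫ u : sphere (0 : Eu n) 1, phi n (gauge K (u : Eu n))⁻¹ *
      ((gauge K (u : Eu n))⁻¹ * (suppFun L (gp K (bpt K u)) - 1)) ∂(sig n) := by
  obtain ⟨δ, m, hδ, hm, hlow⟩ := lower_bound hK hL hK0 hvol hne
  obtain ⟨A, hA⟩ := rho_bdd hK hK0
  obtain ⟨B, hB⟩ := q_bdd hK hL hK0
  have hρm : Measurable fun u : sphere (0 : Eu n) 1 => (gauge K (u : Eu n))⁻¹ := by
    have := (g_cont hK hK0).measurable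
    fun_prop
  have hqm : Measurable fun u : sphere (0 : Eu n) 1 => suppFun L (gp K (bpt K (u : Eu n))) := by
    have h1 := (supp_cont hL).measurable
    have h2 := gp_meas (K := K)
    have h3 := bpt_meas hK hK0
    fun_prop
  obtain ⟨hIntg, hder⟩ := param_deriv (sig n) hρm hqm hA (fun u => hB _) (phi_cont n)
  have hnn : ∀ t ∈ Icc (0 : ℝ) 1, ∀ u : sphere (0 : Eu n) 1, 0 ≤
      ∫ r in (0 : ℝ)..((gauge K (u : Eu n))⁻¹ * (1 + t * (suppFun L (gp K (bpt K u)) - 1))), phi n r := by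
    intro t ht u
    have hg := g_pos hK hK0 (sph_ne u)
    have hq : 0 ≤ suppFun L (gp K (bpt K u)) := by
      simpa using le_supp hL (interior_subset hL0) (gp K (bpt K u))
    apply intervalIntegral.integral_nonneg (mul_nonneg (by positivity) (by nlinarith [ht.1, ht.2]))
    intro r hr
    have := hr.1
    unfold phi; positivity
  refine deriv_pos_aux (d := δ ^ 2 / 2) (by positivity) hm hder (c := (gM n).real K) ?_ ?_
  · rw [measureReal_def, gM_K hn hK hK0, integral_eq_lintegral_of_nonneg_ae
      (ae_of_all _ (hnn 0 (by simp))) (hIntg 0 (by simp)).aestronglyMeasurable]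
    simp
  · intro t ht0 ht1
    have := hlow t ht0 ht1
    rw [← mul_div_assoc]
    refine this.trans ?_
    have ht : t ∈ Icc (0 : ℝ) 1 := ⟨ht0.le, ht1.le⟩
    rw [measureReal_def]
    apply ENNReal.toReal_le_of_le_ofReal (integral_nonneg (hnn t ht))
    rw [ofReal_integral_eq_lintegral_ofReal (hIntg t ht) (ae_of_all _ (hnn t ht))]
    exact gM_Kt hn hK hL hK0 hL0 ht0 ht1

end derivative


section hyper

variable {m : ℕ}

/-- coordinates adapted to an orthonormal basis -/
def hc (b : OrthonormalBasis (Fin (m + 1)) ℝ (Eu (m + 1))) (p : ℝ × (Fin m → ℝ)) : Eu (m + 1) :=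
  b.repr.symm (WithLp.toLp 2 (Fin.cons p.1 p.2 : Fin (m + 1) → ℝ))

theorem hc_mp (b : OrthonormalBasis (Fin (m + 1)) ℝ (Eu (m + 1))) :
    MeasurePreserving (hc b) volume volume := by
  have h1 := (volume_preserving_piFinSuccAbove (fun _ : Fin (m + 1) => ℝ) 0).symm
  have h2 := PiLp.volume_preserving_toLp (Fin (m + 1))
  have h3 := b.repr.symm.measurePreserving
  have := h3.comp (h2.comp h1)
  have e : hc b = b.repr.symm ∘ WithLp.toLp 2 ∘
      (MeasurableEquiv.piFinSuccAbove (fun _ : Fin (m + 1) => ℝ) 0).symm := by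
    funext p
    simp [hc, MeasurableEquiv.piFinSuccAbove, Fin.insertNthEquiv]
  rw [e]
  exact this

theorem hc_inner (b : OrthonormalBasis (Fin (m + 1)) ℝ (Eu (m + 1))) (s : ℝ) (z : Fin m → ℝ) :
    ⟪hc b (s, z), b 0⟫ = s := by
  rw [real_inner_comm, ← b.repr_apply_apply, hc, LinearIsometryEquiv.apply_symm_apply]
  simp

theorem hc_smul (b : OrthonormalBasis (Fin (m + 1)) ℝ (Eu (m + 1))) (c s : ℝ) (z : Fin m → ℝ) :
    c • hc b (s, z) = hc b (c * s, c • z) := by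
  rw [hc, hc, ← LinearIsometryEquiv.map_smul]
  congr 1
  ext i
  refine Fin.cases ?_ (fun j => ?_) i <;> simp

theorem hc_surj (b : OrthonormalBasis (Fin (m + 1)) ℝ (Eu (m + 1))) (x : Eu (m + 1)) :
    ∃ z, x = hc b (⟪x, b 0⟫, z) := by
  refine ⟨fun j => b.repr x j.succ, ?_⟩
  rw [hc, LinearIsometryEquiv.eq_symm_apply]
  ext i
  refine Fin.cases ?_ (fun j => ?_) i
  · simp [b.repr_apply_apply, real_inner_comm]
  · simp

theorem hc_isom (b : OrthonormalBasis (Fin (m + 1)) ℝ (Eu (m + 1))) (a : ℝ) :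
    Isometry (fun z : Eu m => hc b (a, z.ofLp)) := by
  apply b.repr.symm.isometry.comp
  refine Isometry.of_dist_eq fun x y => ?_
  rw [EuclideanSpace.dist_eq, EuclideanSpace.dist_eq, Fin.sum_univ_succ]
  simp

theorem hyper_aux (b : OrthonormalBasis (Fin (m + 1)) ℝ (Eu (m + 1))) {a : ℝ} (ha : 0 < a)
    {A : Set (Eu (m + 1))} (hA : MeasurableSet A) (hAa : ∀ y ∈ A, ⟪y, b 0⟫ = a) :
    volume (Ioc (0 : ℝ) 1 • A) = ENNReal.ofReal (a / (m + 1)) *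
      volume {z : Fin m → ℝ | hc b (a, z) ∈ A} := by
  have hcm : Measurable (hc b) := (hc_mp b).measurable
  have hmem : ∀ x, x ∈ Ioc (0 : ℝ) 1 • A ↔ (0 < ⟪x, b 0⟫ ∧ ⟪x, b 0⟫ ≤ a) ∧ (a / ⟪x, b 0⟫) • x ∈ A := by
    intro x
    constructor
    · rintro ⟨s, hs, y, hy, rfl⟩
      simp only
      have := hs.1
      rw [inner_smul_left, hAa y hy, conj_trivial, smul_smul]
      refine ⟨⟨by positivity, by nlinarith [hs.2]⟩, ?_⟩
      have : a / (s * a) * s = 1 := by field_simp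
      rwa [this, one_smul]
    · rintro ⟨⟨h1, h2⟩, h3⟩
      refine ⟨⟪x, b 0⟫ / a, ⟨by positivity, (div_le_one ha).2 h2⟩, _, h3, ?_⟩
      simp only [smul_smul]
      rw [div_mul_div_cancel₀ ha.ne', div_self h1.ne', one_smul]
  have hmc : MeasurableSet (Ioc (0 : ℝ) 1 • A) := by
    have : Ioc (0 : ℝ) 1 • A = {x | (0 < ⟪x, b 0⟫ ∧ ⟪x, b 0⟫ ≤ a) ∧ (a / ⟪x, b 0⟫) • x ∈ A} := by
      ext x; exact hmem x
    rw [this]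
    have hm : Measurable fun x : Eu (m + 1) => ⟪x, b 0⟫ := by fun_prop
    refine ((measurableSet_lt measurable_const hm).inter (measurableSet_le hm measurable_const)).inter ?_
    exact hA.preimage ((measurable_const.div hm).smul measurable_id)
  rw [← (hc_mp b).measure_preimage hmc.nullMeasurableSet, Measure.volume_eq_prod,
    Measure.prod_apply (hmc.preimage hcm)]
  set V := volume {z : Fin m → ℝ | hc b (a, z) ∈ A} with hV
  have hslice : ∀ s : ℝ, volume (Prod.mk s ⁻¹' (hc b ⁻¹' (Ioc (0 : ℝ) 1 • A))) =
      (Ioc 0 a).indicator (fun s => ENNReal.ofReal ((s / a) ^ m) * V) s := by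
    intro s
    by_cases hs : s ∈ Ioc 0 a
    · rw [indicator_of_mem hs]
      have h0 := hs.1
      have : Prod.mk s ⁻¹' (hc b ⁻¹' (Ioc (0 : ℝ) 1 • A)) = (s / a) • {z : Fin m → ℝ | hc b (a, z) ∈ A} := by
        ext z
        rw [mem_preimage, mem_preimage, hmem, hc_inner, mem_smul_set_iff_inv_smul_mem₀ (by positivity)]
        simp only [mem_Ioc] at hs
        simp only [hs, and_self, true_and, hc_smul, inv_div, mem_setOf_eq]
        rw [div_mul_cancel₀ _ h0.ne']
      rw [this, Measure.addHaar_smul]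
      simp only [Module.finrank_fintype_fun_eq_card, Fintype.card_fin]
      rw [abs_of_nonneg (by positivity)]
    · rw [indicator_of_notMem hs]
      convert measure_empty (μ := (volume : Measure (Fin m → ℝ)))
      ext z
      simp only [mem_preimage, hmem, hc_inner, mem_empty_iff_false, iff_false]
      exact fun h => hs h.1
  simp_rw [hslice]
  rw [lintegral_indicator measurableSet_Ioc, lintegral_mul_const _ (by fun_prop)]
  congr 1
  rw [← ofReal_integral_eq_lintegral_ofReal, ← intervalIntegral.integral_of_le ha.le]
  · congr 1
    simp_rw [div_pow]
    rw [intervalIntegral.integral_div, integral_pow]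
    field_simp
    simp [pow_succ]
  · have : Continuous fun s : ℝ => (s / a) ^ m := by fun_prop
    exact (this.intervalIntegrable 0 a).1
  · filter_upwards [ae_restrict_mem measurableSet_Ioc] with s hs
    have := hs.1
    simp only [Pi.zero_apply]
    positivity

theorem hyper (m : ℕ) : ∃ c : ℝ≥0∞, c ≠ 0 ∧ c ≠ ∞ ∧ ∀ (v : Eu (m + 1)), ‖v‖ = 1 → ∀ a : ℝ, 0 < a →
    ∀ A : Set (Eu (m + 1)), MeasurableSet A → (∀ y ∈ A, ⟪y, v⟫ = a) →
      volume (Ioc (0 : ℝ) 1 • A) = c * ENNReal.ofReal a * μH[(m : ℝ)] A := by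
  have hH : (μH[(m : ℝ)] : Measure (Eu m)).IsAddHaarMeasure := by
    have := isAddHaarMeasure_hausdorffMeasure (E := Eu m)
    simpa using this
  obtain ⟨k, hk0, hkt, hk⟩ : ∃ k : ℝ≥0∞, k ≠ 0 ∧ k ≠ ∞ ∧
      (volume : Measure (Eu m)) = k • (μH[(m : ℝ)] : Measure (Eu m)) := by
    refine ⟨Measure.addHaarScalarFactor volume (μH[(m : ℝ)] : Measure (Eu m)), ?_, by simp, ?_⟩
    · simpa using (Measure.addHaarScalarFactor_pos_of_isAddHaarMeasure _ _).ne'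
    · exact Measure.isAddLeftInvariant_eq_smul _ _
  refine ⟨ENNReal.ofReal (1 / (m + 1)) * k, ?_, ?_, ?_⟩
  · refine mul_ne_zero ?_ hk0
    simp
    positivity
  · exact ENNReal.mul_ne_top (by simp) hkt
  intro v hv a ha A hA hAa
  obtain ⟨b, hb⟩ := Orthonormal.exists_orthonormalBasis_extension_of_card_eq (𝕜 := ℝ)
    (E := Eu (m + 1)) (ι := Fin (m + 1)) (by simp) (v := fun _ => v) (s := {0}) (by
      rw [orthonormal_iff_ite]
      rintro ⟨i, hi⟩ ⟨j, hj⟩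
      simp only [mem_singleton_iff] at hi hj
      subst hi hj
      simp [hv, Set.domRestrict])
  have hb : b 0 = v := hb 0 rfl
  subst hb
  rw [hyper_aux b ha hA hAa]
  have hcm : Measurable (hc b) := (hc_mp b).measurable
  have e1 : volume {z : Fin m → ℝ | hc b (a, z) ∈ A} = volume {z : Eu m | hc b (a, z.ofLp) ∈ A} := by
    have hm : MeasurableSet {z : Fin m → ℝ | hc b (a, z) ∈ A} :=
      hA.preimage (hcm.comp (by fun_prop : Measurable fun z : Fin m → ℝ => (a, z)))
    rw [← (PiLp.volume_preserving_ofLp (Fin m)).measure_preimage hm.nullMeasurableSet]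
    rfl
  have e2 : A = (fun z : Eu m => hc b (a, z.ofLp)) '' {z : Eu m | hc b (a, z.ofLp) ∈ A} := by
    ext x
    constructor
    · intro hx
      obtain ⟨z, hz⟩ := hc_surj b x
      rw [hAa x hx] at hz
      exact ⟨WithLp.toLp 2 z, by simpa [← hz] using hx, by simp [← hz]⟩
    · rintro ⟨z, hz, rfl⟩
      exact hz
  have e3 : μH[(m : ℝ)] A = μH[(m : ℝ)] {z : Eu m | hc b (a, z.ofLp) ∈ A} := by
    conv_lhs => rw [e2]
    exact (hc_isom b a).hausdorffMeasure_image (Or.inl (by positivity)) _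
  rw [e1, hk, e3, Measure.smul_apply, smul_eq_mul, div_eq_mul_one_div,
    ENNReal.ofReal_mul ha.le]
  ring

end hyper


section piece

variable {m : ℕ}

theorem proj_est {E : Set (Eu (m + 1))} {v : Eu (m + 1)} {a ε R κ : ℝ} (ha : 0 < a) (hε : 0 ≤ ε)
    (hR : ∀ x ∈ E, ‖x‖ ≤ R) (h1 : ∀ x ∈ E, a ≤ ⟪x, v⟫ ∧ ⟪x, v⟫ ≤ a * (1 + ε))
    (h2 : ∀ y ∈ E, ∀ z ∈ E, |⟪y - z, v⟫| ≤ ε * ‖y - z‖) (hκ : ε * (1 + R / a) ≤ κ)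
    {y z : Eu (m + 1)} (hy : y ∈ E) (hz : z ∈ E) :
    ‖(a / ⟪y, v⟫) • y - (a / ⟪z, v⟫) • z‖ ≤ (1 + κ) * ‖y - z‖ ∧
    (1 - κ) * ‖y - z‖ ≤ ‖(a / ⟪y, v⟫) • y - (a / ⟪z, v⟫) • z‖ := by
  obtain ⟨y1, y2⟩ := h1 y hy
  obtain ⟨z1, z2⟩ := h1 z hz
  have h3 := h2 y hy z hz
  have h4 := hR z hz
  rw [inner_sub_left] at h3
  set p := ⟪y, v⟫
  set q := ⟪z, v⟫
  have hp : 0 < p := by linarith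
  have hq : 0 < q := by linarith
  have e : (a / p) • y - (a / q) • z = (a / p) • (y - z) + (a / p - a / q) • z := by
    rw [smul_sub, sub_smul]; abel
  set d := ‖y - z‖
  have hd : 0 ≤ d := norm_nonneg _
  have hR0 : 0 ≤ R := (norm_nonneg _).trans h4
  have s1 : ‖(a / p - a / q) • z‖ ≤ ε * (R / a) * d := by
    rw [norm_smul, Real.norm_eq_abs]
    have : a / p - a / q = a * (q - p) / (p * q) := by field_simp
    rw [this, abs_div, abs_mul, abs_of_pos ha, abs_of_pos (mul_pos hp hq), abs_sub_comm]
    have : a * |p - q| / (p * q) ≤ a * (ε * d) / (a * a) := by gcongr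
    calc _ ≤ a * (ε * d) / (a * a) * R := by gcongr
      _ = _ := by field_simp
  have s2 : ‖(a / p) • (y - z)‖ = a / p * d := by
    rw [norm_smul, Real.norm_of_nonneg (by positivity)]
  have s3 : a / p ≤ 1 := (div_le_one hp).2 y1
  have s4 : 1 - ε ≤ a / p := by
    rw [le_div_iff₀ hp]
    by_cases h : 1 - ε ≤ 0
    · nlinarith
    · nlinarith
  have k1 : ε * d + ε * (R / a) * d ≤ κ * d := by nlinarith
  have k0 : 0 ≤ ε * d := by positivity
  rw [e]
  constructor
  · refine (norm_add_le _ _).trans ?_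
    rw [s2]
    nlinarith
  · have : ‖(a / p) • (y - z)‖ - ‖(a / p - a / q) • z‖ ≤ ‖(a / p) • (y - z) + (a / p - a / q) • z‖ := by
      simpa using norm_sub_norm_le ((a / p) • (y - z)) (-((a / p - a / q) • z))
    rw [s2] at this
    nlinarith

theorem piece {c : ℝ≥0∞} (hc : ∀ (v : Eu (m + 1)), ‖v‖ = 1 → ∀ a : ℝ, 0 < a →
    ∀ A : Set (Eu (m + 1)), MeasurableSet A → (∀ y ∈ A, ⟪y, v⟫ = a) →
      volume (Ioc (0 : ℝ) 1 • A) = c * ENNReal.ofReal a * μH[(m : ℝ)] A)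
    {E : Set (Eu (m + 1))} (hE : MeasurableSet E) {v : Eu (m + 1)} (hv : ‖v‖ = 1)
    {a ε R κ : ℝ} (ha : 0 < a) (hε : 0 ≤ ε) (hR0 : 0 ≤ R)
    (hR : ∀ x ∈ E, ‖x‖ ≤ R) (h1 : ∀ x ∈ E, a ≤ ⟪x, v⟫ ∧ ⟪x, v⟫ ≤ a * (1 + ε))
    (h2 : ∀ y ∈ E, ∀ z ∈ E, |⟪y - z, v⟫| ≤ ε * ‖y - z‖) (hκ : ε * (1 + R / a) ≤ κ) (hκ1 : κ < 1) :
    ENNReal.ofReal ((1 - κ) ^ m) * (c * ENNReal.ofReal a * μH[(m : ℝ)] E) ≤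
      volume (Ioc (0 : ℝ) 1 • E) ∧
    volume (Ioc (0 : ℝ) 1 • E) ≤
      ENNReal.ofReal ((1 + κ) ^ (2 * m + 1)) * (c * ENNReal.ofReal a * μH[(m : ℝ)] E) := by
  set P : Eu (m + 1) → Eu (m + 1) := fun y => (a / ⟪y, v⟫) • y with hP
  have hRa : 0 ≤ R / a := by positivity
  have hεκ : ε ≤ κ := by nlinarith
  have hκ0 : 0 ≤ κ := hε.trans hεκ
  have est := fun y hy z hz => proj_est (y := y) (z := z) ha hε hR h1 h2 hκ hy hz
  have hlip : LipschitzOnWith (1 + κ).toNNReal P E := by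
    refine LipschitzOnWith.of_dist_le_mul fun y hy z hz => ?_
    rw [dist_eq_norm, dist_eq_norm, Real.coe_toNNReal _ (by linarith)]
    exact (est y hy z hz).1
  have hinj : InjOn P E := by
    intro y hy z hz hyz
    have := (est y hy z hz).2
    change _ ≤ ‖P y - P z‖ at this
    rw [hyz, sub_self, norm_zero] at this
    have h0 : ‖y - z‖ ≤ 0 := by
      by_contra! h
      nlinarith [mul_pos (sub_pos.2 hκ1) h]
    exact sub_eq_zero.1 (norm_le_zero_iff.1 h0)
  set Q := Function.invFunOn P E with hQ
  have hQP : ∀ y ∈ E, Q (P y) = y := fun y hy => hinj.leftInvOn_invFunOn hy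
  have hlip2 : LipschitzOnWith ((1 - κ)⁻¹).toNNReal Q (P '' E) := by
    refine LipschitzOnWith.of_dist_le_mul ?_
    rintro _ ⟨y, hy, rfl⟩ _ ⟨z, hz, rfl⟩
    have h0 : 0 < 1 - κ := sub_pos.2 hκ1
    rw [hQP y hy, hQP z hz, dist_eq_norm, dist_eq_norm, Real.coe_toNNReal _ (by positivity),
      inv_mul_eq_div, le_div_iff₀ h0, mul_comm]
    exact (est y hy z hz).2
  have hQE : Q '' (P '' E) = E := by
    rw [image_image]
    ext x
    constructor
    · rintro ⟨y, hy, rfl⟩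
      change Q (P y) ∈ E
      rwa [hQP y hy]
    · intro hx; exact ⟨x, hx, hQP x hx⟩
  have hPm : MeasurableSet (P '' E) :=
    hE.image_of_continuousOn_injOn hlip.continuousOn hinj
  have hPv : ∀ y ∈ P '' E, ⟪y, v⟫ = a := by
    rintro _ ⟨y, hy, rfl⟩
    have := (h1 y hy).1
    rw [hP]
    simp only
    rw [inner_smul_left, conj_trivial, div_mul_cancel₀ _ (by linarith)]
  have hvol := hc v hv a ha _ hPm hPv
  have m1 := hlip.hausdorffMeasure_image_le (d := (m : ℝ)) (by positivity)
  have m2 := hlip2.hausdorffMeasure_image_le (d := (m : ℝ)) (by positivity)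
  rw [hQE, ENNReal.rpow_natCast] at m2
  rw [ENNReal.rpow_natCast] at m1
  change _ ≤ ENNReal.ofReal (1 + κ) ^ m * _ at m1
  change _ ≤ ENNReal.ofReal (1 - κ)⁻¹ ^ m * _ at m2
  have h0 : 0 < 1 - κ := sub_pos.2 hκ1
  constructor
  · have sub : Ioc (0 : ℝ) 1 • (P '' E) ⊆ Ioc (0 : ℝ) 1 • E := by
      rintro _ ⟨s, hs, _, ⟨y, hy, rfl⟩, rfl⟩
      have hy1 := (h1 y hy).1
      have hpos : 0 < ⟪y, v⟫ := by linarith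
      have := hs.1
      refine ⟨s * (a / ⟪y, v⟫), ⟨by positivity, ?_⟩, y, hy, by simp [hP, smul_smul]⟩
      exact mul_le_one₀ hs.2 (by positivity) ((div_le_one hpos).2 hy1)
    refine le_trans ?_ (measure_mono sub)
    rw [hvol, mul_left_comm]
    gcongr
    calc _ ≤ ENNReal.ofReal ((1 - κ) ^ m) * (ENNReal.ofReal (1 - κ)⁻¹ ^ m * μH[(m : ℝ)] (P '' E)) := by
          gcongr
      _ = _ := by
          rw [← mul_assoc, ← ENNReal.ofReal_pow (by positivity), ← ENNReal.ofReal_mul (by positivity),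
            ← mul_pow, mul_inv_cancel₀ h0.ne']
          simp
  · have sub : Ioc (0 : ℝ) 1 • E ⊆ (1 + κ) • (Ioc (0 : ℝ) 1 • (P '' E)) := by
      rintro _ ⟨s, hs, y, hy, rfl⟩
      obtain ⟨hy1, hy2⟩ := h1 y hy
      have hpos : 0 < ⟪y, v⟫ := by linarith
      have := hs.1
      refine ⟨_, ⟨s * (⟪y, v⟫ / (a * (1 + κ))), ⟨by positivity, ?_⟩, _, ⟨y, hy, rfl⟩, rfl⟩, ?_⟩
      · refine mul_le_one₀ hs.2 (by positivity) ((div_le_one (by positivity)).2 ?_)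
        nlinarith
      · simp only [hP, smul_smul]
        congr 1
        field_simp
    refine (measure_mono sub).trans ?_
    rw [Measure.addHaar_smul, hvol]
    simp only [finrank_euclideanSpace, Fintype.card_fin]
    rw [abs_of_nonneg (by positivity)]
    calc _ ≤ ENNReal.ofReal ((1 + κ) ^ (m + 1)) * (c * ENNReal.ofReal a *
          (ENNReal.ofReal (1 + κ) ^ m * μH[(m : ℝ)] E)) := by gcongr
      _ = _ := by
          rw [two_mul, add_right_comm, pow_add (1 + κ) (m + 1) m, ENNReal.ofReal_mul (by positivity),
            ENNReal.ofReal_pow (by positivity) m]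
          ring

end piece


section compare

theorem cmp_measure {α : Type*} [MeasurableSpace α] {μ ν : Measure α} {U : ℕ × ℕ → Set α}
    (hU : ∀ i, MeasurableSet (U i)) (h0 : μ (⋃ i, U i)ᶜ = 0)
    (h : ∀ i, ∀ E, MeasurableSet E → E ⊆ U i → μ E ≤ ν E) : μ ≤ ν := by
  set V : ℕ → Set α := fun k => U (Nat.unpair k) with hV
  have hVm : ∀ k, MeasurableSet (disjointed V k) := fun k => MeasurableSet.disjointed (fun k => hU _) k
  have hVU : ⋃ k, disjointed V k = ⋃ i, U i := by
    rw [iUnion_disjointed]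
    exact (Nat.pairEquiv.symm.surjective).iUnion_comp U
  rw [Measure.le_iff]
  intro E hE
  have hd : Pairwise (Function.onFun Disjoint fun k => E ∩ disjointed V k) := fun i j hij =>
    (disjoint_disjointed V hij).mono inter_subset_right inter_subset_right
  calc μ E ≤ μ (E ∩ ⋃ k, disjointed V k) + μ (⋃ i, U i)ᶜ := by
        refine (measure_mono ?_).trans (measure_union_le _ _)
        rw [hVU]
        intro x hx
        by_cases hx' : x ∈ ⋃ i, U i
        · exact Or.inl ⟨hx, hx'⟩
        · exact Or.inr hx'
    _ = ∑' k, μ (E ∩ disjointed V k) := by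
        rw [h0, add_zero, inter_iUnion, measure_iUnion hd fun k => hE.inter (hVm k)]
    _ ≤ ∑' k, ν (E ∩ disjointed V k) := ENNReal.tsum_le_tsum fun k =>
        h (Nat.unpair k) _ (hE.inter (hVm k)) (inter_subset_right.trans (disjointed_subset V k))
    _ = ν (E ∩ ⋃ k, disjointed V k) := by
        rw [inter_iUnion, measure_iUnion hd fun k => hE.inter (hVm k)]
    _ ≤ ν E := measure_mono inter_subset_left

end compare

section coneid

variable {m : ℕ} {K : Set (Eu (m + 1))}

theorem gp_norm (hK : IsConvexBody K) (hK0 : (0 : Eu (m + 1)) ∈ interior K) {x w : Eu (m + 1)}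
    (hx : x ∈ frontier K) (hd : x ∈ gDiff K) (hw1 : ‖w‖ = 1) (hw : ⟪x, w⟫ = suppFun K w) :
    suppFun K w = ‖gp K x‖⁻¹ := by
  have h := normal_eq hK hK0 hx hd hw
  obtain ⟨r, hr, hr2⟩ := supp_lower hK hK0
  have h3 := hr2 w
  rw [hw1, mul_one] at h3
  have h4 : ‖w‖ = suppFun K w * ‖gp K x‖ := by
    conv_lhs => rw [h]
    rw [norm_smul, Real.norm_of_nonneg (by linarith)]
  rw [hw1] at h4
  exact eq_inv_of_mul_eq_one_left h4.symm

theorem pieces (hK : IsConvexBody K) (hK0 : (0 : Eu (m + 1)) ∈ interior K)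
    {c : ℝ≥0∞} (hc : ∀ (v : Eu (m + 1)), ‖v‖ = 1 → ∀ a : ℝ, 0 < a →
    ∀ A : Set (Eu (m + 1)), MeasurableSet A → (∀ y ∈ A, ⟪y, v⟫ = a) →
      volume (Ioc (0 : ℝ) 1 • A) = c * ENNReal.ofReal a * μH[(m : ℝ)] A)
    {κ : ℝ} (hκ : 0 < κ) (hκ1 : κ < 1) :
    ∃ (U : ℕ × ℕ → Set (Eu (m + 1))) (a : ℕ × ℕ → ℝ), (∀ i, MeasurableSet (U i)) ∧
      (frontier K ⊆ ⋃ i, U i) ∧ (∀ i, U i ⊆ frontier K) ∧ (∀ i, 0 < a i) ∧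
      (∀ i, ∀ E, MeasurableSet E → E ⊆ U i →
        ENNReal.ofReal ((1 - κ) ^ m) * (c * ENNReal.ofReal (a i) * μH[(m : ℝ)] E) ≤
          volume (Ioc (0 : ℝ) 1 • E) ∧
        volume (Ioc (0 : ℝ) 1 • E) ≤
          ENNReal.ofReal ((1 + κ) ^ (2 * m + 1)) * (c * ENNReal.ofReal (a i) * μH[(m : ℝ)] E)) ∧
      (∀ i, ∀ x ∈ U i, x ∈ gDiff K →
        a i * (1 - κ) ≤ ‖gp K x‖⁻¹ ∧ ‖gp K x‖⁻¹ ≤ a i * (1 + κ)) := by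
  obtain ⟨r, hr, hr2⟩ := supp_lower hK hK0
  obtain ⟨R, hR⟩ := hK.2.1.isBounded.exists_norm_le
  have hR0 : 0 ≤ R := (norm_nonneg _).trans (hR _ (interior_subset hK0))
  have hfK : frontier K ⊆ K := hK.2.1.isClosed.frontier_subset
  set M := 2 * R / r with hM
  have hM0 : 0 ≤ M := by positivity
  set ε := κ / (1 + M) with hε
  have hε0 : 0 < ε := by positivity
  have hεM : ε * (1 + M) = κ := by rw [hε]; field_simp
  have hRε : R * ε ≤ r / 2 := by
    have : M * r = 2 * R := by rw [hM]; field_simp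
    nlinarith
  haveI : Nonempty (sphere (0 : Eu (m + 1)) 1) :=
    ⟨⟨EuclideanSpace.single 0 1, by simp⟩⟩
  set v : ℕ → Eu (m + 1) := fun j => (TopologicalSpace.denseSeq (sphere (0 : Eu (m + 1)) 1) j : Eu (m + 1)) with hv
  have hv1 : ∀ j, ‖v j‖ = 1 := fun j => norm_eq_of_mem_sphere _
  set a : ℕ × ℕ → ℝ := fun i => (r / 2) * (1 + ε) ^ i.2 with ha
  have hapos : ∀ i, r / 2 ≤ a i := fun i => by
    have : 1 ≤ (1 + ε) ^ i.2 := one_le_pow₀ (by linarith)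
    simp only [ha]
    nlinarith
  set N : ℕ → Set (Eu (m + 1)) := fun j => Prod.fst '' {p : Eu (m + 1) × Eu (m + 1) |
    (p.1 ∈ frontier K ∧ p.2 ∈ sphere (0 : Eu (m + 1)) 1) ∧ ⟪p.1, p.2⟫ = suppFun K p.2 ∧ ‖p.2 - v j‖ ≤ ε} with hN
  have hNc : ∀ j, IsCompact (N j) := by
    intro j
    apply IsCompact.image _ continuous_fst
    have hcomp : IsCompact (frontier K ×ˢ sphere (0 : Eu (m + 1)) 1) :=
      (hK.2.1.of_isClosed_subset isClosed_frontier hfK).prod (isCompact_sphere _ _)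
    refine hcomp.of_isClosed_subset ?_ fun p hp => hp.1
    refine (isClosed_frontier.prod isClosed_sphere).inter (IsClosed.inter ?_ ?_)
    · exact isClosed_eq (continuous_fst.inner continuous_snd) ((supp_cont hK).comp continuous_snd)
    · exact isClosed_le (continuous_snd.sub continuous_const).norm continuous_const
  set U : ℕ × ℕ → Set (Eu (m + 1)) := fun i =>
    N i.1 ∩ {x | a i ≤ ⟪x, v i.1⟫ ∧ ⟪x, v i.1⟫ ≤ a i * (1 + ε)} with hU
  have hUw : ∀ i, ∀ x ∈ U i, x ∈ frontier K ∧ ∃ w, ‖w‖ = 1 ∧ ⟪x, w⟫ = suppFun K w ∧ ‖w - v i.1‖ ≤ ε := by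
    rintro i x ⟨⟨⟨y, w⟩, ⟨⟨h1, h2⟩, h3, h4⟩, rfl⟩, -⟩
    exact ⟨h1, w, by simpa using h2, h3, h4⟩
  have hκa : ∀ i, ε * (1 + R / a i) ≤ κ := by
    intro i
    rw [← hεM]
    gcongr
    rw [hM, div_le_div_iff₀ (by linarith [hapos i]) hr]
    nlinarith [hapos i]
  have hip : ∀ x ∈ frontier K, ∀ y : Eu (m + 1), |⟪x, y⟫| ≤ R * ‖y‖ := fun x hx y =>
    (abs_real_inner_le_norm x y).trans (by gcongr; exact hR x (hfK hx))
  refine ⟨U, a, ?_, ?_, fun i x hx => (hUw i x hx).1, fun i => by linarith [hapos i], ?_, ?_⟩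
  · intro i
    refine (hNc i.1).measurableSet.inter ?_
    have hm : Measurable fun x : Eu (m + 1) => ⟪x, v i.1⟫ := by fun_prop
    exact (measurableSet_le measurable_const hm).inter (measurableSet_le hm measurable_const)
  · intro x hx
    obtain ⟨w, hw1, hw⟩ := exists_normal hK hx
    obtain ⟨j, hj⟩ : ∃ j, ‖w - v j‖ ≤ ε := by
      obtain ⟨j, hj⟩ := (TopologicalSpace.denseRange_denseSeq (sphere (0 : Eu (m + 1)) 1)).exists_dist_lt
        ⟨w, by simpa using hw1⟩ hε0
      refine ⟨j, ?_⟩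
      rw [Subtype.dist_eq, dist_eq_norm] at hj
      exact hj.le
    have hlow : r / 2 ≤ ⟪x, v j⟫ := by
      have h1 := hr2 w
      rw [hw1, mul_one, ← hw] at h1
      have h2 := (hip x hx (w - v j)).trans (mul_le_mul_of_nonneg_left hj hR0)
      rw [inner_sub_right] at h2
      have := (abs_le.1 h2).2
      linarith
    obtain ⟨k, hk1, hk2⟩ := exists_nat_pow_near (x := ⟪x, v j⟫ / (r / 2)) (y := 1 + ε)
      ((one_le_div (by positivity)).2 hlow) (by linarith)
    rw [le_div_iff₀ (by positivity)] at hk1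
    rw [div_lt_iff₀ (by positivity)] at hk2
    refine mem_iUnion.2 ⟨(j, k), ⟨(x, w), ⟨⟨hx, by simpa using hw1⟩, hw, hj⟩, rfl⟩, ?_, ?_⟩
    · simp only [ha]; linarith
    · simp only [ha]; rw [pow_succ] at hk2; nlinarith
  · intro i E hE hEU
    refine piece hc hE (hv1 i.1) (by linarith [hapos i]) hε0.le hR0
      (fun x hx => hR x (hfK (hUw i x (hEU hx)).1)) (fun x hx => (hEU hx).2) ?_ (hκa i) hκ1
    have key : ∀ y ∈ E, ∀ z ∈ E, ⟪z - y, v i.1⟫ ≤ ε * ‖z - y‖ := by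
      intro y hy z hz
      obtain ⟨hy1, w, hw1, hw, hwv⟩ := hUw i y (hEU hy)
      have h1 := le_supp hK (hfK (hUw i z (hEU hz)).1) w
      rw [← hw] at h1
      have h2 : ⟪z - y, v i.1⟫ = ⟪z - y, w⟫ - ⟪z - y, w - v i.1⟫ := by
        rw [inner_sub_right]; ring
      have h3 := (abs_real_inner_le_norm (z - y) (w - v i.1)).trans
        (mul_le_mul_of_nonneg_left hwv (norm_nonneg _))
      have h4 := (abs_le.1 h3).1
      rw [inner_sub_left z y w] at h2
      linarith
    intro y hy z hz
    rw [abs_le]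
    have k1 := key y hy z hz
    have k2 := key z hz y hy
    rw [norm_sub_rev, ← neg_sub y z, inner_neg_left] at k1
    constructor <;> linarith
  · intro i x hx hd
    obtain ⟨hx1, w, hw1, hw, hwv⟩ := hUw i x hx
    obtain ⟨-, hx2, hx3⟩ := hx
    rw [← gp_norm hK hK0 hx1 hd hw1 hw, ← hw]
    have h2 := (hip x hx1 (w - v i.1)).trans (mul_le_mul_of_nonneg_left hwv hR0)
    rw [inner_sub_right, abs_le] at h2
    have hai : 0 < a i := by linarith [hapos i]
    have h3 : ε * a i + ε * R ≤ κ * a i := by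
      have := mul_le_mul_of_nonneg_right (hκa i) hai.le
      have e : ε * (1 + R / a i) * a i = ε * a i + ε * R := by field_simp
      linarith
    have := mul_pos hε0 hai
    constructor <;> nlinarith [h2.1, h2.2]

end coneid


section nus

variable {m : ℕ} {K L : Set (Eu (m + 1))}

/-- cone measure on the boundary -/
def nu1 (K : Set (Eu (m + 1))) : Measure (Eu (m + 1)) := (volume.restrict K).map (bpt K)

/-- surface measure weighted by the support function -/
def nu2 (K : Set (Eu (m + 1))) : Measure (Eu (m + 1)) :=
  ((μH[(m : ℝ)]).restrict (frontier K)).withDensity fun x => ENNReal.ofReal ‖gp K x‖⁻¹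

theorem nu1_apply (hK : IsConvexBody K) (hK0 : (0 : Eu (m + 1)) ∈ interior K) {E : Set (Eu (m + 1))}
    (hE : MeasurableSet E) : nu1 K E = volume (bpt K ⁻¹' E ∩ K) := by
  rw [nu1, Measure.map_apply (bpt_meas hK hK0) hE, Measure.restrict_apply (bpt_meas hK hK0 hE)]

theorem cone_eq (hK : IsConvexBody K) (hK0 : (0 : Eu (m + 1)) ∈ interior K) {E : Set (Eu (m + 1))}
    (hEf : E ⊆ frontier K) : bpt K ⁻¹' E ∩ K = Ioc (0 : ℝ) 1 • E := by
  ext x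
  constructor
  · rintro ⟨h1, h2⟩
    have hx0 : x ≠ 0 := by
      rintro rfl
      have := (g_frontier hK hK0).2 (hEf h1)
      simp [bpt] at this
    have hg := g_pos hK hK0 hx0
    refine ⟨gauge K x, ⟨hg, (g_le_one hK hK0).2 h2⟩, _, h1, ?_⟩
    simp [bpt, smul_smul, hg.ne']
  · rintro ⟨s, hs, y, hy, rfl⟩
    have hs0 := hs.1
    have hy1 := (g_frontier hK hK0).2 (hEf hy)
    have : gauge K (s • y) = s := by rw [g_smul hs0.le, hy1, mul_one]
    constructor
    · simp only [mem_preimage, bpt, this, smul_smul, inv_mul_cancel₀ hs0.ne', one_smul, hy]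
    · simp only
      rw [← g_le_one hK hK0, this]; exact hs.2

theorem nu1_cone (hK : IsConvexBody K) (hK0 : (0 : Eu (m + 1)) ∈ interior K) {E : Set (Eu (m + 1))}
    (hE : MeasurableSet E) (hEf : E ⊆ frontier K) : nu1 K E = volume (Ioc (0 : ℝ) 1 • E) := by
  rw [nu1_apply hK hK0 hE, cone_eq hK hK0 hEf]

theorem frontier_meas : MeasurableSet (frontier K) := isClosed_frontier.measurableSet

theorem nu1_frontier (hK : IsConvexBody K) (hK0 : (0 : Eu (m + 1)) ∈ interior K) :
    nu1 K (frontier K)ᶜ = 0 := by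
  rw [nu1_apply hK hK0 frontier_meas.compl]
  refine measure_mono_null (t := {0}) ?_ (measure_singleton _)
  rintro x ⟨h1, -⟩
  by_contra h
  exact h1 (bpt_frontier hK hK0 h)

theorem nu1_gDiff (hK : IsConvexBody K) (hK0 : (0 : Eu (m + 1)) ∈ interior K) :
    nu1 K (gDiff K)ᶜ = 0 := by
  rw [nu1_apply hK hK0 gDiff_meas.compl]
  refine measure_mono_null (t := {0} ∪ (gDiff K)ᶜ) ?_
    (measure_union_null (measure_singleton _) (gDiff_ae hK hK0))
  rintro x ⟨h1, -⟩
  by_cases h : x = 0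
  · exact Or.inl h
  · right
    intro hx
    exact h1 (gDiff_smul (inv_pos.2 (g_pos hK hK0 h)) hx)

theorem muH_gDiff (hK : IsConvexBody K) (hK0 : (0 : Eu (m + 1)) ∈ interior K) :
    (μH[(m : ℝ)] : Measure (Eu (m + 1))) (frontier K ∩ (gDiff K)ᶜ) = 0 := by
  obtain ⟨c, hc0, hct, hc⟩ := hyper m
  obtain ⟨U, a, hU, hcov, hUf, ha, hE, -⟩ := pieces hK hK0 hc (κ := 1 / 2) (by norm_num) (by norm_num)
  refine measure_mono_null (t := ⋃ i, U i ∩ (gDiff K)ᶜ) ?_ (measure_iUnion_null fun i => ?_)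
  · rintro x ⟨h1, h2⟩
    obtain ⟨i, hi⟩ := mem_iUnion.1 (hcov h1)
    exact mem_iUnion.2 ⟨i, hi, h2⟩
  · have hm := (hU i).inter (gDiff_meas (K := K)).compl
    have h := (hE i _ hm inter_subset_left).1
    rw [← nu1_cone hK hK0 hm (inter_subset_left.trans (hUf i)),
      measure_mono_null inter_subset_right (nu1_gDiff hK hK0), nonpos_iff_eq_zero] at h
    simp only [mul_eq_zero, ENNReal.ofReal_eq_zero, not_le.2 (ha i), hc0, false_or] at h
    rcases h with h | h
    · exact absurd h (by rw [not_le]; positivity)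
    · exact h

theorem gpd_meas : Measurable fun x : Eu (m + 1) => ENNReal.ofReal ‖gp K x‖⁻¹ := by
  have := gp_meas (K := K)
  fun_prop

theorem nu2_apply {E : Set (Eu (m + 1))} (hE : MeasurableSet E) (hEf : E ⊆ frontier K) :
    nu2 K E = ∫⁻ x in E, ENNReal.ofReal ‖gp K x‖⁻¹ ∂μH[(m : ℝ)] := by
  rw [nu2, withDensity_apply _ hE, Measure.restrict_restrict hE, inter_eq_left.2 hEf]

theorem nu2_null (hK : IsConvexBody K) (hK0 : (0 : Eu (m + 1)) ∈ interior K) :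
    nu2 K (frontier K)ᶜ = 0 ∧ nu2 K (gDiff K)ᶜ = 0 := by
  constructor
  · apply withDensity_absolutelyContinuous
    rw [Measure.restrict_apply frontier_meas.compl]; simp
  · apply withDensity_absolutelyContinuous
    rw [Measure.restrict_apply gDiff_meas.compl, inter_comm]; exact muH_gDiff hK hK0

theorem inter_D {ν : Measure (Eu (m + 1))} (h : ν (gDiff K)ᶜ = 0) (E : Set (Eu (m + 1))) :
    ν E = ν (E ∩ gDiff K) := by
  apply le_antisymm _ (measure_mono inter_subset_left)
  calc ν E ≤ ν (E ∩ gDiff K) + ν (gDiff K)ᶜ := by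
        refine (measure_mono ?_).trans (measure_union_le _ _)
        intro x hx
        by_cases hx' : x ∈ gDiff K
        · exact Or.inl ⟨hx, hx'⟩
        · exact Or.inr hx'
    _ = _ := by rw [h, add_zero]

theorem nu_cmp (hK : IsConvexBody K) (hK0 : (0 : Eu (m + 1)) ∈ interior K)
    {c : ℝ≥0∞} (hc : ∀ (v : Eu (m + 1)), ‖v‖ = 1 → ∀ a : ℝ, 0 < a →
    ∀ A : Set (Eu (m + 1)), MeasurableSet A → (∀ y ∈ A, ⟪y, v⟫ = a) →
      volume (Ioc (0 : ℝ) 1 • A) = c * ENNReal.ofReal a * μH[(m : ℝ)] A)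
    {κ : ℝ} (hκ : 0 < κ) (hκ1 : κ < 1) :
    nu1 K ≤ ENNReal.ofReal ((1 + κ) ^ (2 * m + 1) / (1 - κ)) • c • nu2 K ∧
    c • nu2 K ≤ ENNReal.ofReal ((1 + κ) / (1 - κ) ^ m) • nu1 K := by
  obtain ⟨U, a, hU, hcov, hUf, ha, hE, hgp⟩ := pieces hK hK0 hc hκ hκ1
  have hκ' : 0 < 1 - κ := sub_pos.2 hκ1
  obtain ⟨n1, n2⟩ := nu2_null hK hK0
  constructor
  · apply cmp_measure hU (measure_mono_null (compl_subset_compl.2 hcov) (nu1_frontier hK hK0))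
    intro i E hEm hEU
    have hm := hEm.inter (gDiff_meas (K := K))
    have hsub : E ∩ gDiff K ⊆ U i := inter_subset_left.trans hEU
    rw [inter_D (nu1_gDiff hK hK0) E, nu1_cone hK hK0 hm (hsub.trans (hUf i))]
    refine (hE i _ hm hsub).2.trans ?_
    simp only [Measure.smul_apply, smul_eq_mul]
    rw [inter_D n2 E, nu2_apply hm (hsub.trans (hUf i))]
    have : ENNReal.ofReal (a i * (1 - κ)) * μH[(m : ℝ)] (E ∩ gDiff K) ≤
        ∫⁻ x in E ∩ gDiff K, ENNReal.ofReal ‖gp K x‖⁻¹ ∂μH[(m : ℝ)] := by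
      rw [← setLIntegral_const]
      refine setLIntegral_mono' hm fun x hx => ENNReal.ofReal_le_ofReal (hgp i x (hsub hx) hx.2).1
    refine le_trans (le_of_eq ?_) (mul_le_mul_right (mul_le_mul_right this _) _)
    have e : ENNReal.ofReal ((1 + κ) ^ (2 * m + 1)) * ENNReal.ofReal (a i) =
      ENNReal.ofReal ((1 + κ) ^ (2 * m + 1) / (1 - κ)) * ENNReal.ofReal (a i * (1 - κ)) := by
      rw [← ENNReal.ofReal_mul (by positivity), ← ENNReal.ofReal_mul (by positivity)]
      congr 1
      field_simp
    calc _ = c * (ENNReal.ofReal ((1 + κ) ^ (2 * m + 1)) * ENNReal.ofReal (a i)) * μH[(m : ℝ)] (E ∩ gDiff K) := by ring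
      _ = _ := by rw [e]; ring
  · have n1' : (c • nu2 K) (⋃ i, U i)ᶜ = 0 := by
      rw [Measure.smul_apply, measure_mono_null (compl_subset_compl.2 hcov) n1, smul_zero]
    apply cmp_measure hU n1'
    intro i E hEm hEU
    have hm := hEm.inter (gDiff_meas (K := K))
    have hsub : E ∩ gDiff K ⊆ U i := inter_subset_left.trans hEU
    simp only [Measure.smul_apply, smul_eq_mul]
    rw [inter_D (nu1_gDiff hK hK0) E, nu1_cone hK hK0 hm (hsub.trans (hUf i))]
    rw [inter_D n2 E, nu2_apply hm (hsub.trans (hUf i))]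
    refine le_trans ?_ (mul_le_mul_right (hE i _ hm hsub).1 _)
    have : ∫⁻ x in E ∩ gDiff K, ENNReal.ofReal ‖gp K x‖⁻¹ ∂μH[(m : ℝ)] ≤
        ENNReal.ofReal (a i * (1 + κ)) * μH[(m : ℝ)] (E ∩ gDiff K) := by
      rw [← setLIntegral_const]
      refine setLIntegral_mono' hm fun x hx => ENNReal.ofReal_le_ofReal (hgp i x (hsub hx) hx.2).2
    refine (mul_le_mul_right this _).trans (le_of_eq ?_)
    have hai := ha i
    have e : ENNReal.ofReal (a i * (1 + κ)) = ENNReal.ofReal ((1 + κ) / (1 - κ) ^ m) *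
        (ENNReal.ofReal ((1 - κ) ^ m) * ENNReal.ofReal (a i)) := by
      rw [← ENNReal.ofReal_mul (by positivity), ← ENNReal.ofReal_mul (by positivity)]
      congr 1
      field_simp
    rw [e]; ring

theorem le_of_scaled {X Y : ℝ≥0∞} {f : ℝ → ℝ} (hf : ContinuousAt f 0) (hf0 : f 0 = 1)
    (h : ∀ κ, 0 < κ → κ < 1 → X ≤ ENNReal.ofReal (f κ) * Y) : X ≤ Y := by
  have t : Tendsto (fun κ : ℝ => ENNReal.ofReal (f κ) * Y) (𝓝[>] 0) (𝓝 (1 * Y)) := by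
    refine ENNReal.Tendsto.mul_const ?_ (Or.inl one_ne_zero)
    have := (ENNReal.tendsto_ofReal hf.tendsto).mono_left (nhdsWithin_le_nhds (s := Ioi 0))
    rwa [hf0, ENNReal.ofReal_one] at this
  rw [one_mul] at t
  refine ge_of_tendsto t ?_
  filter_upwards [self_mem_nhdsWithin,
    mem_nhdsWithin_of_mem_nhds (gt_mem_nhds (show (0 : ℝ) < 1 by norm_num))] with κ h1 h2
  exact h κ h1 h2

theorem nu_eq (hK : IsConvexBody K) (hK0 : (0 : Eu (m + 1)) ∈ interior K) :
    ∃ c : ℝ≥0∞, c ≠ 0 ∧ c ≠ ∞ ∧ nu2 K = c • nu1 K := by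
  obtain ⟨c, hc0, hct, hc⟩ := hyper m
  refine ⟨c⁻¹, ENNReal.inv_ne_zero.2 hct, ENNReal.inv_ne_top.2 hc0, ?_⟩
  have : nu1 K = c • nu2 K := by
    ext E hE
    apply le_antisymm
    · refine le_of_scaled (f := fun κ => (1 + κ) ^ (2 * m + 1) / (1 - κ)) ?_ (by simp)
        fun κ h1 h2 => (nu_cmp hK hK0 hc h1 h2).1 E
      exact ContinuousAt.div (by fun_prop) (by fun_prop) (by norm_num)
    · refine le_of_scaled (f := fun κ => (1 + κ) / (1 - κ) ^ m) ?_ (by simp)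
        fun κ h1 h2 => (nu_cmp hK hK0 hc h1 h2).2 E
      exact ContinuousAt.div (by fun_prop) (by fun_prop) (by norm_num)
  rw [this, smul_smul, ENNReal.inv_mul_cancel hc0 hct, one_smul]

theorem nu1_polar (hK : IsConvexBody K) (hK0 : (0 : Eu (m + 1)) ∈ interior K) :
    nu1 K = ((sig (m + 1)).withDensity fun u => ENNReal.ofReal
      ((gauge K (u : Eu (m + 1)))⁻¹ ^ (m + 1) / (m + 1))).map fun u : sphere (0 : Eu (m + 1)) 1 => bpt K (u : Eu (m + 1)) := by
  have hbm := bpt_meas hK hK0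
  have hbm' : Measurable fun u : sphere (0 : Eu (m + 1)) 1 => bpt K (u : Eu (m + 1)) := by fun_prop
  ext E hE
  have hKm := hK.2.1.measurableSet
  rw [nu1_apply hK hK0 hE, Measure.map_apply hbm' hE, withDensity_apply _ (hbm' hE),
    ← lintegral_indicator_one ((hbm hE).inter hKm), polar (by omega)
      (measurable_one.indicator ((hbm hE).inter hKm)), ← lintegral_indicator (hbm' hE)]
  refine lintegral_congr fun u => ?_
  have hg := g_pos hK hK0 (sph_ne u)
  have hb : ∀ r : ℝ, 0 < r → bpt K (r • (u : Eu (m + 1))) = bpt K (u : Eu (m + 1)) := by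
    intro r hr
    rw [bpt, bpt, g_smul hr.le, smul_smul]
    congr 1
    field_simp
  by_cases hu : bpt K (u : Eu (m + 1)) ∈ E
  · rw [indicator_of_mem (by exact hu)]
    have e : ∀ r ∈ Ioi (0 : ℝ), ENNReal.ofReal (r ^ (m + 1 - 1)) *
        (bpt K ⁻¹' E ∩ K).indicator (1 : Eu (m + 1) → ℝ≥0∞) (r • (u : Eu (m + 1))) =
        (Iic (gauge K (u : Eu (m + 1)))⁻¹).indicator (fun r => ENNReal.ofReal (r ^ m)) r := by
      intro r hr
      have hr : 0 < r := hr
      have : r • (u : Eu (m + 1)) ∈ bpt K ⁻¹' E ∩ K ↔ r ∈ Iic (gauge K (u : Eu (m + 1)))⁻¹ := by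
        rw [mem_inter_iff, mem_preimage, hb r hr, ← g_le_one hK hK0, g_smul hr.le, mem_Iic,
          ← one_div, le_div_iff₀ hg]
        simp [hu]
      by_cases h : r ∈ Iic (gauge K (u : Eu (m + 1)))⁻¹
      · rw [indicator_of_mem h, indicator_of_mem (this.2 h)]; simp
      · rw [indicator_of_notMem h, indicator_of_notMem (fun h' => h (this.1 h'))]; simp
    rw [setLIntegral_congr_fun measurableSet_Ioi e, setLIntegral_indicator measurableSet_Iic,
      Iic_inter_Ioi, ← ofReal_integral_eq_lintegral_ofReal,
      ← intervalIntegral.integral_of_le (by positivity), integral_pow]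
    · simp
    · exact ((continuous_pow m).intervalIntegrable 0 _).1
    · filter_upwards [ae_restrict_mem measurableSet_Ioc] with r hr
      have := hr.1
      simp only [Pi.zero_apply]; positivity
  · rw [indicator_of_notMem (by exact hu)]
    rw [setLIntegral_congr_fun (g := fun _ => 0) measurableSet_Ioi]
    · simp
    · intro r hr
      simp only
      rw [indicator_of_notMem, mul_zero]
      rintro ⟨h, -⟩
      rw [mem_preimage, hb r hr] at h
      exact hu h

end nus


section final

variable {m : ℕ} {K L : Set (Eu (m + 1))}

theorem int_nu2 (F : Eu (m + 1) → ℝ) :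
    ∫ x in frontier K, ‖gp K x‖⁻¹ * F x ∂μH[(m : ℝ)] = ∫ x, F x ∂(nu2 K) := by
  rw [nu2, integral_withDensity_eq_integral_toReal_smul gpd_meas (ae_of_all _ fun x => by simp)]
  refine integral_congr_ae (ae_of_all _ fun x => ?_)
  simp only [smul_eq_mul]
  rw [ENNReal.toReal_ofReal (by positivity)]

theorem int_nu1 (hK : IsConvexBody K) (hK0 : (0 : Eu (m + 1)) ∈ interior K)
    {F : Eu (m + 1) → ℝ} (hF : Measurable F) :
    ∫ x, F x ∂(nu1 K) = ∫ u : sphere (0 : Eu (m + 1)) 1,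
      (gauge K (u : Eu (m + 1)))⁻¹ ^ (m + 1) / (m + 1) * F (bpt K u) ∂(sig (m + 1)) := by
  have hbm := bpt_meas hK hK0
  have hgm := (g_cont hK hK0).measurable
  have hbm' : Measurable fun u : sphere (0 : Eu (m + 1)) 1 => bpt K (u : Eu (m + 1)) := by fun_prop
  rw [nu1_polar hK hK0, integral_map hbm'.aemeasurable hF.aestronglyMeasurable,
    integral_withDensity_eq_integral_toReal_smul (by fun_prop) (ae_of_all _ fun x => by simp)]
  refine integral_congr_ae (ae_of_all _ fun u => ?_)
  have hg := g_pos hK hK0 (sph_ne u)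
  simp only [smul_eq_mul]
  rw [ENNReal.toReal_ofReal (by positivity)]

instance nu1_fin [Fact (IsConvexBody K)] : IsFiniteMeasure (nu1 K) := by
  have : IsFiniteMeasure (volume.restrict K) :=
    ⟨by rw [Measure.restrict_apply_univ]; exact (Fact.out (p := IsConvexBody K)).2.1.measure_lt_top⟩
  unfold nu1; infer_instance

theorem bdry_eq (hK : IsConvexBody K) (hL : IsConvexBody L) (hK0 : (0 : Eu (m + 1)) ∈ interior K) :
    ∫ x in frontier K, suppFun L (gaussMap K x) * Real.exp (-‖x‖ ^ 2 / 2) ∂μH[(m : ℝ)] =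
      ∫ x, suppFun L (gp K x) * gD x ∂(nu2 K) := by
  rw [← int_nu2]
  refine integral_congr_ae ?_
  have h1 : ∀ᵐ x ∂((μH[(m : ℝ)] : Measure (Eu (m + 1))).restrict (frontier K)), x ∈ gDiff K := by
    rw [ae_restrict_iff' frontier_meas, ae_iff]
    convert muH_gDiff hK hK0 using 2
    ext x; simp
  filter_upwards [h1, ae_restrict_mem frontier_meas] with x hd hx
  obtain ⟨a, b⟩ := gaussMap_spec hK hx
  have e := gp_norm hK hK0 hx hd a b
  have e2 := normal_eq hK hK0 hx hd b
  rw [e] at e2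
  have hpos : 0 < ‖gp K x‖⁻¹ := by
    refine lt_of_le_of_ne (by positivity) fun h => ?_
    rw [← h, zero_smul] at e2
    rw [e2] at a; simp at a
  rw [e2, supp_smul hL hpos, gD]
  ring

theorem bdry_eq_self (hK : IsConvexBody K) (hK0 : (0 : Eu (m + 1)) ∈ interior K) :
    ∫ x in frontier K, suppFun K (gaussMap K x) * Real.exp (-‖x‖ ^ 2 / 2) ∂μH[(m : ℝ)] =
      ∫ x, gD x ∂(nu2 K) := by
  rw [← int_nu2]
  refine integral_congr_ae ?_
  have h1 : ∀ᵐ x ∂((μH[(m : ℝ)] : Measure (Eu (m + 1))).restrict (frontier K)), x ∈ gDiff K := by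
    rw [ae_restrict_iff' frontier_meas, ae_iff]
    convert muH_gDiff hK hK0 using 2
    ext x; simp
  filter_upwards [h1, ae_restrict_mem frontier_meas] with x hd hx
  obtain ⟨a, b⟩ := gaussMap_spec hK hx
  rw [gp_norm hK hK0 hx hd a b, gD]

theorem main_lt (hK : IsConvexBody K) (hL : IsConvexBody L) (hK0 : (0 : Eu (m + 1)) ∈ interior K)
    (hL0 : (0 : Eu (m + 1)) ∈ interior L) (hvol : gM (m + 1) K = gM (m + 1) L) (hne : K ≠ L) :
    ∫ x in frontier K, suppFun K (gaussMap K x) * Real.exp (-‖x‖ ^ 2 / 2) ∂μH[(m : ℝ)] <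
    ∫ x in frontier K, suppFun L (gaussMap K x) * Real.exp (-‖x‖ ^ 2 / 2) ∂μH[(m : ℝ)] := by
  rw [bdry_eq hK hL hK0, bdry_eq_self hK hK0]
  obtain ⟨c, hc0, hct, hc⟩ := nu_eq hK hK0
  haveI : Fact (IsConvexBody K) := ⟨hK⟩
  have hgm : Measurable (gD (n := m + 1)) := gD_cont.measurable
  have hsm : Measurable fun x => suppFun L (gp K x) := (supp_cont hL).measurable.comp gp_meas
  obtain ⟨B, hB⟩ := q_bdd hK hL hK0
  have i1 : Integrable (gD (n := m + 1)) (nu1 K) := integrable_of_bdd' hgm (C := 1) fun x => by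
    rw [abs_of_pos (gD_pos x)]; exact gD_le_one x
  have i2 : Integrable (fun x => (suppFun L (gp K x) - 1) * gD x) (nu1 K) :=
    integrable_of_bdd' (by fun_prop) (C := B) fun x => by
      rw [abs_mul, abs_of_pos (gD_pos x)]
      exact (mul_le_of_le_one_right (abs_nonneg _) (gD_le_one x)).trans (hB x)
  have i3 : Integrable (fun x => suppFun L (gp K x) * gD x) (nu1 K) := by
    refine (i2.add i1).congr (ae_of_all _ fun x => ?_)
    simp only [Pi.add_apply]; ring
  rw [hc, integral_smul_measure, integral_smul_measure, ← sub_pos, ← smul_sub,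
    ← integral_sub i3 i1]
  refine smul_pos (ENNReal.toReal_pos hc0 hct) ?_
  rw [int_nu1 hK hK0 (by fun_prop)]
  have h := div_pos (deriv_pos (by omega) hK hL hK0 hL0 hvol hne)
    (show (0 : ℝ) < (m : ℝ) + 1 by positivity)
  rw [← integral_div] at h
  refine h.trans_eq (integral_congr_ae (ae_of_all _ fun u => ?_))
  have hg := g_pos hK hK0 (sph_ne u)
  have hn : ‖bpt K (u : Eu (m + 1))‖ = (gauge K (u : Eu (m + 1)))⁻¹ := by
    rw [bpt, norm_smul, norm_eq_of_mem_sphere, mul_one, Real.norm_of_nonneg (by positivity)]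
  simp only [phi, gD, hn, Nat.add_sub_cancel]
  ring

end final

theorem gM_of_vol {n : ℕ} {K L : Set (Eu n)} (hK : IsConvexBody K) (hL : IsConvexBody L)
    (hvol : gaussVol n K = gaussVol n L) : gM n K = gM n L := by
  have h0 : (Real.sqrt (2 * Real.pi))⁻¹ ^ n ≠ 0 := by positivity
  have h := mul_left_cancel₀ h0 hvol
  have h' : (gM n).real K = (gM n).real L := by
    rw [gM_real_eq hK.2.1.measurableSet, gM_real_eq hL.2.1.measurableSet]; exact h
  exact (ENNReal.toReal_eq_toReal_iff' (gM_finite_of_compact hK.2.1 subset_rfl)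
    (gM_finite_of_compact hL.2.1 subset_rfl)).1 h'

theorem gaussian_minkowski_first_variation_inequality
    (n : ℕ) (hn : 2 ≤ n) (K L : Set (Eu n)) (hK : IsConvexBody K) (hL : IsConvexBody L)
    (hK0 : (0 : Eu n) ∈ interior K) (hL0 : (0 : Eu n) ∈ interior L)
    (hvol : gaussVol n K = gaussVol n L) :
    (Real.sqrt (2 * Real.pi))⁻¹ ^ n *
        ∫ x in frontier K, suppFun K (gaussMap K x) * Real.exp (-‖x‖ ^ 2 / 2)
          ∂μH[(n : ℝ) - 1] ≤
      (Real.sqrt (2 * Real.pi))⁻¹ ^ n *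
        ∫ x in frontier K, suppFun L (gaussMap K x) * Real.exp (-‖x‖ ^ 2 / 2)
          ∂μH[(n : ℝ) - 1] ∧
    ((Real.sqrt (2 * Real.pi))⁻¹ ^ n *
        ∫ x in frontier K, suppFun L (gaussMap K x) * Real.exp (-‖x‖ ^ 2 / 2)
          ∂μH[(n : ℝ) - 1] =
      (Real.sqrt (2 * Real.pi))⁻¹ ^ n *
        ∫ x in frontier K, suppFun K (gaussMap K x) * Real.exp (-‖x‖ ^ 2 / 2)
          ∂μH[(n : ℝ) - 1] ↔ K = L) := by
  by_cases hne : K = L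
  · subst hne
    simp
  · obtain ⟨m, rfl⟩ : ∃ m, n = m + 1 := ⟨n - 1, by omega⟩
    have e : ((m + 1 : ℕ) : ℝ) - 1 = m := by push_cast; ring
    rw [e]
    have h := mul_lt_mul_of_pos_left (main_lt hK hL hK0 hL0 (gM_of_vol hK hL hvol) hne)
      (show 0 < (Real.sqrt (2 * Real.pi))⁻¹ ^ (m + 1) by positivity)
    exact ⟨h.le, ⟨fun h' => absurd h' h.ne', fun h' => absurd h' hne⟩⟩
end
end

section
/- Let n ≥ 2 and let K and L be convex bodies in ℝⁿ containing the origin in their interiors such that K ∪ L is also convex. Then the Gaussian surface area measure is a valuation: S_{γ_n,K∪L}(η) + S_{γ_n,K∩L}(η) = S_{γ_n,K}(η) + S_{γ_n,L}(η) for every Borel set η ⊆ S^{n-1}. -/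
open MeasureTheory Metric Set Filter
open scoped RealInnerProductSpace Topology Pointwise NNReal ENNReal

noncomputable section

def IsSupp {n : ℕ} (M : Set (Eu n)) (x v : Eu n) : Prop := ∀ y ∈ M, ⟪y, v⟫ ≤ ⟪x, v⟫

lemma supp_iff {n : ℕ} {M : Set (Eu n)} (hM : IsCompact M) {x : Eu n} (hx : x ∈ M) (v : Eu n) :
    ⟪x, v⟫ = suppFun M v ↔ IsSupp M x v := by
  have hb : BddAbove ((fun y => ⟪y, v⟫) '' M) :=
    (hM.image (by fun_prop)).bddAbove
  constructor
  · intro h y hy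
    rw [h]
    exact le_csSup hb ⟨y, hy, rfl⟩
  · intro h
    apply le_antisymm
    · exact le_csSup hb ⟨x, hx, rfl⟩
    · refine csSup_le ⟨⟪x, v⟫, x, hx, rfl⟩ ?_
      rintro _ ⟨y, hy, rfl⟩
      exact h y hy

lemma isSupp_local {n : ℕ} {M N : Set (Eu n)} (hMN : M ⊆ N) (hN : Convex ℝ N) {x : Eu n}
    (hx : x ∈ N) (hloc : ∀ᶠ y in 𝓝 x, y ∈ N → y ∈ M) (v : Eu n) :
    IsSupp M x v ↔ IsSupp N x v := by
  refine ⟨fun h z hz => ?_, fun h z hz => h z (hMN hz)⟩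
  have hc : Tendsto (fun t : ℝ => (1 - t) • x + t • z) (𝓝[>] 0) (𝓝 x) := by
    have : Continuous (fun t : ℝ => (1 - t) • x + t • z) := by fun_prop
    exact (this.tendsto' 0 x (by simp)).mono_left nhdsWithin_le_nhds
  have h1 : ∀ᶠ t : ℝ in 𝓝[>] 0, t ≤ 1 :=
    nhdsWithin_le_nhds (Iic_mem_nhds (by norm_num))
  obtain ⟨t, ht, ht1, ht0⟩ :=
    ((hc.eventually hloc).and (h1.and self_mem_nhdsWithin)).exists
  have ht0 : 0 < t := ht0
  have hm := ht (hN hx hz (by linarith) ht0.le (by ring))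
  have := h _ hm
  rw [inner_add_left, inner_smul_left, inner_smul_left] at this
  simp at this
  nlinarith

lemma exists_supp {n : ℕ} {M : Set (Eu n)} (hM : Convex ℝ M) (h0 : (0 : Eu n) ∈ interior M)
    {x : Eu n} (hx : x ∈ frontier M) : ∃ v : Eu n, ‖v‖ = 1 ∧ IsSupp M x v := by
  obtain ⟨f, hf⟩ := geometric_hahn_banach_open_point hM.interior isOpen_interior hx.2
  set w := (InnerProductSpace.toDual ℝ (Eu n)).symm f with hw
  have hfw : ∀ y, f y = ⟪y, w⟫ := by
    intro y
    rw [real_inner_comm, hw, InnerProductSpace.toDual_symm_apply]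
  have hle : ∀ y ∈ M, ⟪y, w⟫ ≤ ⟪x, w⟫ := by
    intro y hy
    have hy' : y ∈ closure (interior M) := by
      rw [hM.closure_interior_eq_closure_of_nonempty_interior ⟨0, h0⟩]
      exact subset_closure hy
    have hcl : IsClosed {y : Eu n | ⟪y, w⟫ ≤ ⟪x, w⟫} :=
      isClosed_le (by fun_prop) (by fun_prop)
    refine closure_minimal (fun z hz => ?_) hcl hy'
    have := hf z hz
    rw [hfw, hfw] at this
    exact this.le
  have hw0 : w ≠ 0 := by
    intro h
    have := hf 0 h0
    rw [hfw, hfw, h] at this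
    simp at this
  have hwn : 0 < ‖w‖ := norm_pos_iff.2 hw0
  refine ⟨‖w‖⁻¹ • w, ?_, fun y hy => ?_⟩
  · rw [norm_smul, norm_inv, norm_norm, inv_mul_cancel₀ hwn.ne']
  · rw [inner_smul_right, inner_smul_right]
    exact mul_le_mul_of_nonneg_left (hle y hy) (inv_nonneg.2 hwn.le)

lemma inner_le_gauge {n : ℕ} {M : Set (Eu n)} (h0 : M ∈ 𝓝 (0 : Eu n))
    {x v : Eu n} (hs : IsSupp M x v) (z : Eu n) : ⟪z, v⟫ ≤ gauge M z * ⟪x, v⟫ := by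
  have hc : 0 ≤ ⟪x, v⟫ := by simpa using hs 0 (mem_of_mem_nhds h0)
  have key : ∀ t > gauge M z, ⟪z, v⟫ ≤ t * ⟪x, v⟫ := by
    intro t ht
    obtain ⟨b, hb, hbt, y, hy, rfl⟩ := exists_lt_of_gauge_lt (absorbent_nhds_zero h0) ht
    simp only [inner_smul_left]
    have := hs y hy
    simp
    nlinarith
  have hT : Tendsto (fun t : ℝ => t * ⟪x, v⟫) (𝓝[>] (gauge M z)) (𝓝 (gauge M z * ⟪x, v⟫)) := by
    have : Continuous (fun t : ℝ => t * ⟪x, v⟫) := by fun_prop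
    exact (this.tendsto _).mono_left nhdsWithin_le_nhds
  exact ge_of_tendsto hT (eventually_mem_nhdsWithin.mono key)

lemma supp_pos {n : ℕ} {M : Set (Eu n)} (h0 : M ∈ 𝓝 (0 : Eu n))
    {x v : Eu n} (hv : ‖v‖ = 1) (hs : IsSupp M x v) : 0 < ⟪x, v⟫ := by
  have hc : 0 ≤ ⟪x, v⟫ := by simpa using hs 0 (mem_of_mem_nhds h0)
  have := inner_le_gauge h0 hs v
  rw [real_inner_self_eq_norm_sq, hv] at this
  rcases hc.eq_or_lt with h | h
  · rw [← h] at this; norm_num at this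
  · exact h

/-- Uniqueness of the normal where the gauge restricted to an affine chart is differentiable. -/
lemma normal_unique {n : ℕ} {V : Type*} [NormedAddCommGroup V] [NormedSpace ℝ V]
    {M : Set (Eu n)} (h0 : M ∈ 𝓝 (0 : Eu n))
    (A : V →L[ℝ] Eu n) (e : Eu n)
    (hspan : ∀ w : Eu n, (∀ z, ⟪A z, w⟫ = 0) → ⟪e, w⟫ = 0 → w = 0)
    (y : V) (hd : DifferentiableAt ℝ (fun z => gauge M (A z + e)) y)
    {x : Eu n} (hx : A y + e = gauge M (A y + e) • x) {v w : Eu n} (hv : ‖v‖ = 1) (hw : ‖w‖ = 1)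
    (hsv : IsSupp M x v) (hsw : IsSupp M x w) : v = w := by
  set f := fun z => gauge M (A z + e) with hf
  have key : ∀ u : Eu n, ‖u‖ = 1 → IsSupp M x u →
      (∀ z, ⟪A z, (⟪x, u⟫)⁻¹ • u⟫ = fderiv ℝ f y z) ∧ ⟪e, (⟪x, u⟫)⁻¹ • u⟫ = f y - fderiv ℝ f y y := by
    intro u hu hsu
    have hc := supp_pos h0 hu hsu
    set c := ⟪x, u⟫ with hcdef
    let g : V → ℝ := fun z => f z * c - ⟪A z + e, u⟫
    have hmin : IsLocalMin g y := by
      refine Eventually.of_forall fun z => ?_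
      have h1 : g y = 0 := by
        simp only [g]
        rw [hx, inner_smul_left]
        simp [hf, ← hcdef]
      have h2 := inner_le_gauge h0 hsu (A z + e)
      simp only [h1]
      simp only [g, hf]
      linarith
    have hd1 : HasFDerivAt g (c • fderiv ℝ f y - (innerSL ℝ u).comp A) y := by
      have h1 : HasFDerivAt (fun z => f z * c) (c • fderiv ℝ f y) y := hd.hasFDerivAt.mul_const c
      have h2 : HasFDerivAt (fun z => ⟪A z + e, u⟫) ((innerSL ℝ u).comp A) y := by
        have : (fun z => ⟪A z + e, u⟫) = fun z => ((innerSL ℝ u).comp A) z + ⟪e, u⟫ := by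
          funext z
          simp [inner_add_left, real_inner_comm]
        rw [this]
        exact ((innerSL ℝ u).comp A).hasFDerivAt.add_const _
      exact h1.sub h2
    have h3 := hmin.hasFDerivAt_eq_zero hd1
    have h4 : ∀ z, ⟪A z, c⁻¹ • u⟫ = fderiv ℝ f y z := by
      intro z
      have := congrArg (fun T => T z) h3
      simp at this
      rw [inner_smul_right, real_inner_comm]
      field_simp
      linarith
    refine ⟨h4, ?_⟩
    have h5 : ⟪A y + e, c⁻¹ • u⟫ = f y := by
      rw [hx, inner_smul_left, inner_smul_right, ← hcdef]
      simp [hf]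
      field_simp
    rw [inner_add_left, h4] at h5
    linarith
  obtain ⟨a1, a2⟩ := key v hv hsv
  obtain ⟨b1, b2⟩ := key w hw hsw
  have hcv := supp_pos h0 hv hsv
  have hcw := supp_pos h0 hw hsw
  have heq : (⟪x, v⟫)⁻¹ • v = (⟪x, w⟫)⁻¹ • w := by
    rw [← sub_eq_zero]
    apply hspan
    · intro z; rw [inner_sub_right, a1, b1, sub_self]
    · rw [inner_sub_right, a2, b2, sub_self]
  have hn := congrArg norm heq
  rw [norm_smul, norm_smul, hv, hw, mul_one, mul_one, Real.norm_of_nonneg (inv_nonneg.2 hcv.le),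
    Real.norm_of_nonneg (inv_nonneg.2 hcw.le)] at hn
  rw [hn] at heq
  exact smul_right_injective _ (inv_pos.2 hcw).ne' heq

def Sing {n : ℕ} (M : Set (Eu n)) : Set (Eu n) :=
  {x | x ∈ frontier M ∧ ∃ v w : Eu n, ‖v‖ = 1 ∧ ‖w‖ = 1 ∧ IsSupp M x v ∧ IsSupp M x w ∧ v ≠ w}

lemma chart_lip {n : ℕ} {V : Type*} [NormedAddCommGroup V] [NormedSpace ℝ V]
    {M : Set (Eu n)} (hM : Convex ℝ M) (h0 : M ∈ 𝓝 (0 : Eu n)) (hb : IsCompact M)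
    (A : V →L[ℝ] Eu n) (e : Eu n) (hnorm : ∀ z, 1 ≤ ‖A z + e‖) :
    ∃ C : ℝ≥0, LipschitzOnWith C (fun z => (gauge M (A z + e))⁻¹ • (A z + e)) (closedBall 0 1) := by
  obtain ⟨C, hC⟩ := hM.lipschitz_gauge h0
  obtain ⟨R, hR, hMR⟩ := hb.isBounded.exists_pos_norm_le
  have hlow : ∀ z, R⁻¹ ≤ gauge M (A z + e) := by
    intro z
    have h1 : ‖A z + e‖ / R ≤ gauge M (A z + e) :=
      le_gauge_of_subset_closedBall (absorbent_nhds_zero h0) hR.le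
        (fun y hy => by simpa using hMR y hy)
    have h2 : 1 / R ≤ ‖A z + e‖ / R := by gcongr; exact hnorm z
    rw [one_div] at h2
    exact h2.trans h1
  have hinv : ∀ z, (gauge M (A z + e))⁻¹ ≤ R := fun z =>
    inv_le_of_inv_le₀ hR (hlow z)
  have hpos : ∀ z, 0 < gauge M (A z + e) := fun z => (inv_pos.2 hR).trans_le (hlow z)
  refine ⟨Real.toNNReal (R * ‖A‖ + R * R * (C * ‖A‖) * (‖A‖ + ‖e‖)), ?_⟩
  apply LipschitzOnWith.of_dist_le_mul
  intro y hy z hz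
  have hnn : 0 ≤ R * ‖A‖ + R * R * (C * ‖A‖) * (‖A‖ + ‖e‖) := by positivity
  rw [Real.coe_toNNReal _ hnn, dist_eq_norm, dist_eq_norm]
  set p := gauge M (A y + e) with hp
  set q := gauge M (A z + e) with hq
  have hAyz : (A y + e) - (A z + e) = A (y - z) := by rw [map_sub]; abel
  have hpq : |q - p| ≤ C * ‖A‖ * ‖y - z‖ := by
    have := hC.dist_le_mul (A z + e) (A y + e)
    rw [Real.dist_eq, dist_comm, dist_eq_norm, hAyz] at this
    refine this.trans ?_
    rw [mul_assoc]
    gcongr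
    exact A.le_opNorm _
  have hzn : ‖A z + e‖ ≤ ‖A‖ + ‖e‖ := by
    refine (norm_add_le _ _).trans ?_
    gcongr
    refine (A.le_opNorm z).trans ?_
    have : ‖z‖ ≤ 1 := by simpa using hz
    nlinarith [norm_nonneg A]
  have hid : p⁻¹ • (A y + e) - q⁻¹ • (A z + e) =
      p⁻¹ • A (y - z) + (p⁻¹ * q⁻¹ * (q - p)) • (A z + e) := by
    have : p⁻¹ * q⁻¹ * (q - p) = p⁻¹ - q⁻¹ := by
      have h1 : p ≠ 0 := (hpos y).ne'
      have h2 : q ≠ 0 := (hpos z).ne'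
      field_simp
    rw [this, ← hAyz, smul_sub, sub_smul]
    abel
  show ‖p⁻¹ • (A y + e) - q⁻¹ • (A z + e)‖ ≤ _
  rw [hid]
  refine (norm_add_le _ _).trans ?_
  rw [norm_smul, norm_smul, Real.norm_eq_abs, Real.norm_eq_abs, abs_mul, abs_mul,
    abs_of_pos (inv_pos.2 (hpos y)), abs_of_pos (inv_pos.2 (hpos z))]
  have hp1 := hinv y
  have hq1 := hinv z
  have hp0 := (inv_pos.2 (hpos y)).le
  have hq0 := (inv_pos.2 (hpos z)).le
  have e1 : p⁻¹ * ‖A (y - z)‖ ≤ R * (‖A‖ * ‖y - z‖) := by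
    gcongr
    exact A.le_opNorm _
  have e2 : p⁻¹ * q⁻¹ * |q - p| * ‖A z + e‖ ≤ R * R * (C * ‖A‖ * ‖y - z‖) * (‖A‖ + ‖e‖) := by
    gcongr
  calc _ ≤ _ := add_le_add e1 e2
    _ = _ := by ring

/-- The affine charts: faces of the cube. -/
def chartLin (m : ℕ) (i : Fin (m + 1)) : (Fin m → ℝ) →L[ℝ] Eu (m + 1) :=
  LinearMap.toContinuousLinearMap
    { toFun := fun y => WithLp.toLp 2 (Fin.insertNth (α := fun _ => ℝ) i 0 y)
      map_add' := by
        intro x y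
        ext j
        refine Fin.succAboveCases i ?_ (fun k => ?_) j <;> simp
      map_smul' := by
        intro c y
        ext j
        refine Fin.succAboveCases i ?_ (fun k => ?_) j <;> simp }

lemma chartLin_self (m : ℕ) (i : Fin (m + 1)) (y : Fin m → ℝ) : chartLin m i y i = 0 := by
  simp [chartLin]

lemma chartLin_succAbove (m : ℕ) (i : Fin (m + 1)) (y : Fin m → ℝ) (k : Fin m) :
    chartLin m i y (i.succAbove k) = y k := by
  simp [chartLin]

def chartPt (m : ℕ) (i : Fin (m + 1)) (s : Bool) : Eu (m + 1) :=
  EuclideanSpace.single i (if s then 1 else -1)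

lemma chart_norm (m : ℕ) (i : Fin (m + 1)) (s : Bool) (z : Fin m → ℝ) :
    1 ≤ ‖chartLin m i z + chartPt m i s‖ := by
  have := PiLp.norm_apply_le (chartLin m i z + chartPt m i s) i
  refine le_trans ?_ this
  rw [PiLp.add_apply, chartLin_self]
  cases s <;> simp [chartPt]

lemma chart_span (m : ℕ) (i : Fin (m + 1)) (s : Bool) (w : Eu (m + 1))
    (h1 : ∀ z, ⟪chartLin m i z, w⟫ = 0) (h2 : ⟪chartPt m i s, w⟫ = 0) : w = 0 := by
  ext j
  refine Fin.succAboveCases i ?_ (fun k => ?_) j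
  · rw [chartPt, EuclideanSpace.inner_single_left] at h2
    cases s <;> simpa using h2
  · have := h1 (Pi.single k 1)
    have he : chartLin m i (Pi.single k 1) = EuclideanSpace.single (i.succAbove k) (1 : ℝ) := by
      ext l
      refine Fin.succAboveCases i ?_ (fun k' => ?_) l
      · rw [chartLin_self]; simp
      · rw [chartLin_succAbove]; simp [Pi.single_apply]
    rw [he, EuclideanSpace.inner_single_left] at this
    simpa using this

lemma chart_cover {m : ℕ} {M : Set (Eu (m + 1))} (hM : Convex ℝ M)
    (h0 : M ∈ 𝓝 (0 : Eu (m + 1))) {x : Eu (m + 1)} (hx : x ∈ frontier M) :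
    ∃ (i : Fin (m + 1)) (s : Bool), ∃ y ∈ closedBall (0 : Fin m → ℝ) 1,
      chartLin m i y + chartPt m i s = gauge M (chartLin m i y + chartPt m i s) • x ∧
      0 < gauge M (chartLin m i y + chartPt m i s) := by
  have hg := (gauge_eq_one_iff_mem_frontier hM h0).2 hx
  have hx0 : x ≠ 0 := by
    rintro rfl
    simp at hg
  obtain ⟨i, -, hi⟩ := Finset.exists_max_image Finset.univ (fun j => |x j|) Finset.univ_nonempty
  have hxi : 0 < |x i| := by
    rw [abs_pos]
    intro h
    apply hx0
    ext j
    have := hi j (Finset.mem_univ _)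
    rw [h, abs_zero] at this
    simpa using this
  refine ⟨i, decide (0 < x i), fun k => |x i|⁻¹ * x (i.succAbove k), ?_, ?_⟩
  · rw [mem_closedBall_zero_iff, pi_norm_le_iff_of_nonneg zero_le_one]
    intro k
    rw [norm_mul, norm_inv, Real.norm_eq_abs, Real.norm_eq_abs, abs_abs, inv_mul_le_iff₀ hxi, mul_one]
    exact hi _ (Finset.mem_univ _)
  · have he : chartLin m i (fun k => |x i|⁻¹ * x (i.succAbove k)) + chartPt m i (decide (0 < x i))
        = |x i|⁻¹ • x := by
      ext l
      refine Fin.succAboveCases i ?_ (fun k' => ?_) l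
      · rw [PiLp.add_apply, chartLin_self]
        rcases lt_or_ge 0 (x i) with h | h
        · simp [chartPt, h, abs_of_pos h, h.ne']
        · have h' : x i < 0 := lt_of_le_of_ne h (abs_pos.1 hxi)
          simp [chartPt, h.not_gt, abs_of_neg h', inv_neg, h'.ne]
      · rw [PiLp.add_apply, chartLin_succAbove]; simp [chartPt]
    rw [he, gauge_smul_of_nonneg (inv_nonneg.2 hxi.le), hg, smul_eq_mul, mul_one]
    exact ⟨rfl, inv_pos.2 hxi⟩

lemma frontier_finite {m : ℕ} {M : Set (Eu (m + 1))} (hM : Convex ℝ M)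
    (h0 : M ∈ 𝓝 (0 : Eu (m + 1))) (hb : IsCompact M) :
    μH[(m : ℝ)] (frontier M) < ⊤ := by
  have hsub : frontier M ⊆ ⋃ (i : Fin (m + 1)), ⋃ (s : Bool),
      (fun z => (gauge M (chartLin m i z + chartPt m i s))⁻¹ • (chartLin m i z + chartPt m i s)) ''
        closedBall 0 1 := by
    intro x hx
    obtain ⟨i, s, y, hy, h1, h2⟩ := chart_cover hM h0 hx
    simp only [mem_iUnion]
    refine ⟨i, s, y, hy, ?_⟩
    show (gauge M (chartLin m i y + chartPt m i s))⁻¹ • (chartLin m i y + chartPt m i s) = x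
    rw [inv_smul_eq_iff₀ h2.ne']
    exact h1
  refine (measure_mono hsub).trans_lt ?_
  refine (measure_iUnion_le _).trans_lt ?_
  rw [tsum_fintype]
  refine ENNReal.sum_lt_top.2 fun i _ => ?_
  refine (measure_iUnion_le _).trans_lt ?_
  rw [tsum_fintype]
  refine ENNReal.sum_lt_top.2 fun s _ => ?_
  obtain ⟨C, hC⟩ := chart_lip hM h0 hb (chartLin m i) (chartPt m i s) (chart_norm m i s)
  refine (hC.hausdorffMeasure_image_le (Nat.cast_nonneg m)).trans_lt ?_
  have hvol : (μH[(m : ℝ)] : Measure (Fin m → ℝ)) = volume := by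
    have := hausdorffMeasure_pi_real (ι := Fin m)
    simpa using this
  rw [hvol]
  refine ENNReal.mul_lt_top (ENNReal.rpow_lt_top_of_nonneg (Nat.cast_nonneg m) ENNReal.coe_ne_top) ?_
  exact (isCompact_closedBall _ _).measure_lt_top

lemma sing_null {m : ℕ} {M : Set (Eu (m + 1))} (hM : Convex ℝ M)
    (h0 : M ∈ 𝓝 (0 : Eu (m + 1))) (hb : IsCompact M) :
    μH[(m : ℝ)] (Sing M) = 0 := by
  have hsub : Sing M ⊆ ⋃ (i : Fin (m + 1)), ⋃ (s : Bool),
      (fun z => (gauge M (chartLin m i z + chartPt m i s))⁻¹ • (chartLin m i z + chartPt m i s)) ''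
        (closedBall 0 1 ∩
          {y | ¬ DifferentiableAt ℝ (fun z => gauge M (chartLin m i z + chartPt m i s)) y}) := by
    rintro x ⟨hx, v, w, hv, hw, hsv, hsw, hne⟩
    obtain ⟨i, s, y, hy, h1, h2⟩ := chart_cover hM h0 hx
    simp only [mem_iUnion]
    refine ⟨i, s, y, ⟨hy, fun hd => hne ?_⟩, ?_⟩
    · exact normal_unique h0 _ _ (chart_span m i s) y hd h1 hv hw hsv hsw
    · show (gauge M (chartLin m i y + chartPt m i s))⁻¹ • (chartLin m i y + chartPt m i s) = x
      rw [inv_smul_eq_iff₀ h2.ne']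
      exact h1
  refine measure_mono_null hsub ?_
  refine measure_iUnion_null fun i => measure_iUnion_null fun s => ?_
  obtain ⟨C, hC⟩ := chart_lip hM h0 hb (chartLin m i) (chartPt m i s) (chart_norm m i s)
  refine le_antisymm (((hC.mono inter_subset_left).hausdorffMeasure_image_le
    (Nat.cast_nonneg m)).trans ?_) bot_le
  have hvol : (μH[(m : ℝ)] : Measure (Fin m → ℝ)) = volume := by
    have := hausdorffMeasure_pi_real (ι := Fin m)
    simpa using this
  obtain ⟨D, hD⟩ := hM.lipschitz_gauge h0
  have hlip : LipschitzWith (D * (‖chartLin m i‖₊ + 0))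
      (fun z => gauge M (chartLin m i z + chartPt m i s)) :=
    hD.comp ((chartLin m i).lipschitz.add (LipschitzWith.const _))
  have hnull : volume {y | ¬ DifferentiableAt ℝ
      (fun z => gauge M (chartLin m i z + chartPt m i s)) y} = 0 :=
    ae_iff.1 (hlip.ae_differentiableAt (μ := volume))
  rw [hvol, measure_mono_null inter_subset_right hnull, mul_zero]

def nuInv {n : ℕ} (K η : Set (Eu n)) : Set (Eu n) :=
  {x | x ∈ frontier K ∧ ∃ v ∈ η, ⟪x, v⟫ = suppFun K v}

lemma mem_nuInv {n : ℕ} {K : Set (Eu n)} (hK : IsCompact K) (η : Set (Eu n)) (x : Eu n) :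
    x ∈ nuInv K η ↔ x ∈ frontier K ∧ ∃ v ∈ η, IsSupp K x v := by
  refine and_congr_right fun hx => ?_
  have hxK : x ∈ K := hK.isClosed.frontier_subset hx
  simp only [supp_iff hK hxK]

lemma frontier_congr_nhds {n : ℕ} {M N : Set (Eu n)} {x : Eu n}
    (h : ∀ᶠ y in 𝓝 x, y ∈ M ↔ y ∈ N) : x ∈ frontier M ↔ x ∈ frontier N := by
  rw [frontier_eq_closure_inter_closure, frontier_eq_closure_inter_closure, mem_inter_iff,
    mem_inter_iff, mem_closure_iff_frequently, mem_closure_iff_frequently,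
    mem_closure_iff_frequently, mem_closure_iff_frequently]
  exact and_congr (frequently_congr h) (frequently_congr (h.mono fun y hy => not_congr hy))

/-- Locality of the inverse Gauss image. -/
lemma nuInv_local {n : ℕ} {M N η : Set (Eu n)} (hM : IsCompact M) (hN : IsCompact N)
    (hMN : M ⊆ N) (hc : Convex ℝ N) {x : Eu n}
    (hloc : ∀ᶠ y in 𝓝 x, y ∈ N → y ∈ M) : x ∈ nuInv M η ↔ x ∈ nuInv N η := by
  rw [mem_nuInv hM, mem_nuInv hN,
    frontier_congr_nhds (hloc.mono fun y hy => ⟨fun h => hMN h, hy⟩)]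
  refine and_congr_right fun hx => ?_
  simp only [isSupp_local hMN hc (hN.isClosed.frontier_subset hx) hloc]

lemma frontier_union {n : ℕ} {K L : Set (Eu n)} (hK : Convex ℝ K) (hL : Convex ℝ L)
    (hU : Convex ℝ (K ∪ L)) (hK0 : K ∈ 𝓝 (0 : Eu n)) (hL0 : L ∈ 𝓝 (0 : Eu n)) {x : Eu n}
    (hxK : x ∈ frontier K) (hxL : x ∈ frontier L) : x ∈ frontier (K ∪ L) := by
  have hU0 : K ∪ L ∈ 𝓝 (0 : Eu n) := mem_of_superset hK0 subset_union_left
  have hkc := frontier_subset_closure hxK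
  refine ⟨closure_mono subset_union_left hkc, fun hi => ?_⟩
  have hT : Tendsto (fun t : ℝ => t • x) (𝓝[>] 1) (𝓝 x) := by
    have : Continuous (fun t : ℝ => t • x) := by fun_prop
    exact (this.tendsto' 1 x (by simp)).mono_left nhdsWithin_le_nhds
  obtain ⟨t, ht, ht1⟩ := ((hT.eventually (mem_interior_iff_mem_nhds.1 hi)).and
    self_mem_nhdsWithin).exists
  have ht1 : 1 < t := ht1
  have key : ∀ M : Set (Eu n), Convex ℝ M → M ∈ 𝓝 (0 : Eu n) → x ∈ frontier M → t • x ∉ M := by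
    intro M hM hM0 hxM hm
    have h1 := (gauge_eq_one_iff_mem_frontier hM hM0).2 hxM
    have h2 := gauge_le_one_of_mem hm
    rw [gauge_smul_of_nonneg (by linarith), h1, smul_eq_mul, mul_one] at h2
    linarith
  rcases ht with h | h
  · exact key K hK hK0 hxK h
  · exact key L hL hL0 hxL h

/-- On the common boundary away from singular points all four sets coincide. -/
lemma nuInv_common {n : ℕ} {K L η : Set (Eu n)} (hK : Convex ℝ K) (hL : Convex ℝ L)
    (hU : Convex ℝ (K ∪ L)) (hKc : IsCompact K) (hLc : IsCompact L)
    (hK0 : K ∈ 𝓝 (0 : Eu n)) (hL0 : L ∈ 𝓝 (0 : Eu n)) (hη : η ⊆ sphere (0 : Eu n) 1) {x : Eu n}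
    (hxK : x ∈ frontier K) (hxL : x ∈ frontier L) (hS : x ∉ Sing (K ∩ L)) :
    x ∈ frontier (K ∪ L) ∧ x ∈ frontier (K ∩ L) ∧
    ∃ v : Eu n, (x ∈ nuInv (K ∪ L) η ↔ v ∈ η) ∧ (x ∈ nuInv (K ∩ L) η ↔ v ∈ η) ∧
      (x ∈ nuInv K η ↔ v ∈ η) ∧ (x ∈ nuInv L η ↔ v ∈ η) := by
  have hfU := frontier_union hK hL hU hK0 hL0 hxK hxL
  have hxK' := hKc.isClosed.frontier_subset hxK
  have hxL' := hLc.isClosed.frontier_subset hxL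
  have hfI : x ∈ frontier (K ∩ L) :=
    ⟨subset_closure ⟨hxK', hxL'⟩, fun h => hxK.2 (interior_mono inter_subset_left h)⟩
  refine ⟨hfU, hfI, ?_⟩
  have hU0 : K ∪ L ∈ 𝓝 (0 : Eu n) := mem_of_superset hK0 subset_union_left
  obtain ⟨v, hv, hs⟩ := exists_supp hU (mem_interior_iff_mem_nhds.2 hU0) hfU
  have hsK : IsSupp K x v := fun y hy => hs y (Or.inl hy)
  have hsL : IsSupp L x v := fun y hy => hs y (Or.inr hy)
  have hsI : IsSupp (K ∩ L) x v := fun y hy => hsK y hy.1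
  have huniq : ∀ w ∈ η, IsSupp (K ∩ L) x w → w = v := by
    intro w hw hsw
    by_contra hne
    exact hS ⟨hfI, w, v, by simpa using hη hw, hv, hsw, hsI, hne⟩
  refine ⟨v, ?_, ?_, ?_, ?_⟩
  · rw [mem_nuInv (hKc.union hLc)]
    exact ⟨fun ⟨_, w, hw, h⟩ => huniq w hw (fun y hy => h y (Or.inl hy.1)) ▸ hw,
      fun h => ⟨hfU, v, h, hs⟩⟩
  · rw [mem_nuInv (hKc.inter hLc)]
    exact ⟨fun ⟨_, w, hw, h⟩ => huniq w hw h ▸ hw, fun h => ⟨hfI, v, h, hsI⟩⟩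
  · rw [mem_nuInv hKc]
    exact ⟨fun ⟨_, w, hw, h⟩ => huniq w hw (fun y hy => h y hy.1) ▸ hw,
      fun h => ⟨hxK, v, h, hsK⟩⟩
  · rw [mem_nuInv hLc]
    exact ⟨fun ⟨_, w, hw, h⟩ => huniq w hw (fun y hy => h y hy.2) ▸ hw,
      fun h => ⟨hxL, v, h, hsL⟩⟩

lemma exp_integrableOn {m : ℕ} {M : Set (Eu (m + 1))} (hM : Convex ℝ M)
    (h0 : M ∈ 𝓝 (0 : Eu (m + 1))) (hb : IsCompact M) (η : Set (Eu (m + 1))) :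
    IntegrableOn (fun x : Eu (m + 1) => Real.exp (-‖x‖ ^ 2 / 2)) (nuInv M η) μH[(m : ℝ)] := by
  have hfin := frontier_finite hM h0 hb
  refine IntegrableOn.mono_set (t := frontier M) ?_ (fun x hx => hx.1)
  refine Measure.integrableOn_of_bounded (M := 1) hfin.ne ?_ ?_
  · exact (by fun_prop : Continuous fun x : Eu (m + 1) =>
      Real.exp (-‖x‖ ^ 2 / 2)).aestronglyMeasurable
  · refine Eventually.of_forall fun x => ?_
    rw [Real.norm_eq_abs, abs_of_pos (Real.exp_pos _), Real.exp_le_one_iff]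
    nlinarith [sq_nonneg ‖x‖]

lemma valuation_aux (m : ℕ) (K L : Set (Eu (m + 1))) (hK : Convex ℝ K) (hL : Convex ℝ L)
    (hU : Convex ℝ (K ∪ L)) (hKc : IsCompact K) (hLc : IsCompact L)
    (hK0 : K ∈ 𝓝 (0 : Eu (m + 1))) (hL0 : L ∈ 𝓝 (0 : Eu (m + 1)))
    (η : Set (Eu (m + 1))) (hη : η ⊆ sphere (0 : Eu (m + 1)) 1)
    (f : Eu (m + 1) → ℝ) (hf : f = fun x => Real.exp (-‖x‖ ^ 2 / 2))
    (μ : Measure (Eu (m + 1))) (hμ : μ = μH[(m : ℝ)]) :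
    ∫ x in nuInv (K ∪ L) η, f x ∂μ + ∫ x in nuInv (K ∩ L) η, f x ∂μ =
      ∫ x in nuInv K η, f x ∂μ + ∫ x in nuInv L η, f x ∂μ := by
  have hU0 : K ∪ L ∈ 𝓝 (0 : Eu (m + 1)) := mem_of_superset hK0 subset_union_left
  have hI0 : K ∩ L ∈ 𝓝 (0 : Eu (m + 1)) := inter_mem hK0 hL0
  have iU : IntegrableOn f (nuInv (K ∪ L) η) μ := by
    subst hf hμ; exact exp_integrableOn hU hU0 (hKc.union hLc) η
  have iI : IntegrableOn f (nuInv (K ∩ L) η) μ := by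
    subst hf hμ; exact exp_integrableOn (hK.inter hL) hI0 (hKc.inter hLc) η
  have iK : IntegrableOn f (nuInv K η) μ := by
    subst hf hμ; exact exp_integrableOn hK hK0 hKc η
  have iL : IntegrableOn f (nuInv L η) μ := by
    subst hf hμ; exact exp_integrableOn hL hL0 hLc η
  have hnull : μ (Sing (K ∩ L)) = 0 := by
    subst hμ; exact sing_null (hK.inter hL) hI0 (hKc.inter hLc)
  have mK : MeasurableSet K := hKc.measurableSet
  have mL : MeasurableSet L := hLc.measurableSet
  have miK : MeasurableSet (interior K) := isOpen_interior.measurableSet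
  have miL : MeasurableSet (interior L) := isOpen_interior.measurableSet
  -- membership
  have subU : ∀ x ∈ nuInv (K ∪ L) η, x ∈ K ∪ L := fun x hx =>
    (hKc.union hLc).isClosed.frontier_subset hx.1
  have subI : ∀ x ∈ nuInv (K ∩ L) η, x ∈ K ∩ L := fun x hx =>
    (hKc.inter hLc).isClosed.frontier_subset hx.1
  have subK : ∀ x ∈ nuInv K η, x ∈ K := fun x hx => hKc.isClosed.frontier_subset hx.1
  have subL : ∀ x ∈ nuInv L η, x ∈ L := fun x hx => hLc.isClosed.frontier_subset hx.1
  -- locality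
  have l1 : ∀ x, x ∉ L → (x ∈ nuInv K η ↔ x ∈ nuInv (K ∪ L) η) := fun x hx =>
    nuInv_local hKc (hKc.union hLc) subset_union_left hU
      (Eventually.mono (hLc.isClosed.isOpen_compl.mem_nhds hx) fun y hy h => h.resolve_right hy)
  have l2 : ∀ x, x ∉ K → (x ∈ nuInv L η ↔ x ∈ nuInv (K ∪ L) η) := fun x hx =>
    nuInv_local hLc (hKc.union hLc) subset_union_right hU
      (Eventually.mono (hKc.isClosed.isOpen_compl.mem_nhds hx) fun y hy h => h.resolve_left hy)
  have l3 : ∀ x, x ∈ interior L → (x ∈ nuInv (K ∩ L) η ↔ x ∈ nuInv K η) := fun x hx =>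
    nuInv_local (hKc.inter hLc) hKc inter_subset_left hK
      (Eventually.mono (mem_interior_iff_mem_nhds.1 hx) fun y hy h => ⟨h, hy⟩)
  have l4 : ∀ x, x ∈ interior K → (x ∈ nuInv (K ∩ L) η ↔ x ∈ nuInv L η) := fun x hx =>
    nuInv_local (hKc.inter hLc) hLc inter_subset_right hL
      (Eventually.mono (mem_interior_iff_mem_nhds.1 hx) fun y hy h => ⟨hy, h⟩)
  -- splits
  have sU1 := integral_inter_add_sdiff mL iU
  have sU2 := integral_inter_add_sdiff mK (iU.mono_set (inter_subset_left (t := L)))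
  have sI1 := integral_inter_add_sdiff miL iI
  have sI2 := integral_inter_add_sdiff miK (iI.mono_set (sdiff_subset (t := interior L)))
  have sK1 := integral_inter_add_sdiff mL iK
  have sK2 := integral_inter_add_sdiff miL (iK.mono_set (inter_subset_left (t := L)))
  have sL1 := integral_inter_add_sdiff mK iL
  have sL2 := integral_inter_add_sdiff miK (iL.mono_set (inter_subset_left (t := K)))
  have e1 : nuInv (K ∪ L) η \ L = nuInv K η \ L := by
    ext x; exact and_congr_left fun h => (l1 x h).symm
  have e2 : (nuInv (K ∪ L) η ∩ L) \ K = nuInv L η \ K := by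
    ext x
    constructor
    · rintro ⟨⟨h1, _⟩, h3⟩; exact ⟨(l2 x h3).2 h1, h3⟩
    · rintro ⟨h1, h3⟩; exact ⟨⟨(l2 x h3).1 h1, subL x h1⟩, h3⟩
  have e3 : nuInv (K ∩ L) η ∩ interior L = nuInv K η ∩ L ∩ interior L := by
    ext x
    constructor
    · rintro ⟨h1, h2⟩; exact ⟨⟨(l3 x h2).1 h1, interior_subset h2⟩, h2⟩
    · rintro ⟨⟨h1, _⟩, h2⟩; exact ⟨(l3 x h2).2 h1, h2⟩
  have e4 : (nuInv (K ∩ L) η \ interior L) ∩ interior K = nuInv L η ∩ K ∩ interior K := by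
    ext x
    constructor
    · rintro ⟨⟨h1, _⟩, h2⟩; exact ⟨⟨(l4 x h2).1 h1, interior_subset h2⟩, h2⟩
    · rintro ⟨⟨h1, _⟩, h2⟩; exact ⟨⟨(l4 x h2).2 h1, fun h => h1.1.2 h⟩, h2⟩
  -- common part
  have hae : ∀ᵐ x ∂μ, x ∉ Sing (K ∩ L) := measure_eq_zero_iff_ae_notMem.1 hnull
  have hcommon := fun x (h1 : x ∈ frontier K) (h2 : x ∈ frontier L) (h3 : x ∉ Sing (K ∩ L)) =>
    nuInv_common hK hL hU hKc hLc hK0 hL0 hη h1 h2 h3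
  have fU : ∀ x ∈ nuInv (K ∪ L) η ∩ L ∩ K, x ∈ frontier K ∧ x ∈ frontier L := by
    rintro x ⟨⟨h1, h2⟩, h3⟩
    exact ⟨⟨subset_closure h3, fun h => h1.1.2 (interior_mono subset_union_left h)⟩,
      ⟨subset_closure h2, fun h => h1.1.2 (interior_mono subset_union_right h)⟩⟩
  have fI : ∀ x ∈ (nuInv (K ∩ L) η \ interior L) \ interior K,
      x ∈ frontier K ∧ x ∈ frontier L := by
    rintro x ⟨⟨h1, h2⟩, h3⟩
    exact ⟨⟨subset_closure (subI x h1).1, h3⟩, ⟨subset_closure (subI x h1).2, h2⟩⟩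
  have fK : ∀ x ∈ (nuInv K η ∩ L) \ interior L, x ∈ frontier K ∧ x ∈ frontier L := by
    rintro x ⟨⟨h1, h2⟩, h3⟩
    exact ⟨h1.1, ⟨subset_closure h2, h3⟩⟩
  have fL : ∀ x ∈ (nuInv L η ∩ K) \ interior K, x ∈ frontier K ∧ x ∈ frontier L := by
    rintro x ⟨⟨h1, h2⟩, h3⟩
    exact ⟨⟨subset_closure h2, h3⟩, h1.1⟩
  have c1 : (nuInv (K ∪ L) η ∩ L ∩ K : Set (Eu (m + 1))) =ᵐ[μ]
      ((nuInv K η ∩ L) \ interior L : Set (Eu (m + 1))) := by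
    filter_upwards [hae] with x hx
    refine propext ⟨fun h => ?_, fun h => ?_⟩
    · obtain ⟨hk, hl⟩ := fU x h
      obtain ⟨-, -, v, a, b, c, d⟩ := hcommon x hk hl hx
      exact ⟨⟨c.2 (a.1 h.1.1), h.1.2⟩, hl.2⟩
    · obtain ⟨hk, hl⟩ := fK x h
      obtain ⟨-, -, v, a, b, c, d⟩ := hcommon x hk hl hx
      exact ⟨⟨a.2 (c.1 h.1.1), h.1.2⟩, subK x h.1.1⟩
  have c2 : ((nuInv (K ∩ L) η \ interior L) \ interior K : Set (Eu (m + 1))) =ᵐ[μ]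
      ((nuInv L η ∩ K) \ interior K : Set (Eu (m + 1))) := by
    filter_upwards [hae] with x hx
    refine propext ⟨fun h => ?_, fun h => ?_⟩
    · obtain ⟨hk, hl⟩ := fI x h
      obtain ⟨-, -, v, a, b, c, d⟩ := hcommon x hk hl hx
      exact ⟨⟨d.2 (b.1 h.1.1), (subI x h.1.1).1⟩, hk.2⟩
    · obtain ⟨hk, hl⟩ := fL x h
      obtain ⟨-, -, v, a, b, c, d⟩ := hcommon x hk hl hx
      exact ⟨⟨b.2 (d.1 h.1.1), hl.2⟩, hk.2⟩
  have c1' := setIntegral_congr_set (f := f) c1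
  have c2' := setIntegral_congr_set (f := f) c2
  rw [e1] at sU1
  rw [e2] at sU2
  rw [e3] at sI1
  rw [e4] at sI2
  linarith

/-- The Gaussian surface area measure is a valuation: if `K ∪ L` is convex, then
`S_{γₙ,K∪L} + S_{γₙ,K∩L} = S_{γₙ,K} + S_{γₙ,L}`. -/
theorem gaussian_surface_valuation
    (n : ℕ) (hn : 2 ≤ n) (K L : Set (Eu n)) (hK : IsConvexBody K) (hL : IsConvexBody L)
    (hK0 : (0 : Eu n) ∈ interior K) (hL0 : (0 : Eu n) ∈ interior L)
    (hunion : Convex ℝ (K ∪ L)) :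
    ∀ η ⊆ sphere (0 : Eu n) 1, MeasurableSet η →
      gaussSurf n (K ∪ L) η + gaussSurf n (K ∩ L) η =
        gaussSurf n K η + gaussSurf n L η := by
  obtain ⟨m, rfl⟩ : ∃ m, n = m + 1 := ⟨n - 1, by omega⟩
  intro η hη _
  have hd : (((m + 1 : ℕ) : ℝ) - 1) = (m : ℝ) := by push_cast; ring
  have h := valuation_aux m K L hK.1 hL.1 hunion hK.2.1 hL.2.1
    (mem_interior_iff_mem_nhds.1 hK0) (mem_interior_iff_mem_nhds.1 hL0) η hη _ rfl _ rfl
  simp only [nuInv] at h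
  simp only [gaussSurf, hd]
  rw [← mul_add, ← mul_add, h]
end
end
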